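/- arXiv:2304.09557 — 2 statements merged into one kernel-verified Lean document; each statement's English description precedes it below -/
import Mathlib

section
/- (Equality of differential counts and triple Hurwitz numbers.) Let $a,b\ge0$, $c_1,\ldots,c_n\ge2$ with $a+b-\sum c_i=-2$. The map $f\mapsto df$ induces a bijection between: degree-$(\sum c_i-n)$ rational functions $f$ on $\mathbb{CP}^1$, up to isomorphism, with ramification profile $(a+1)$ over $0$, $(b+1)$ over $1$, and $(c_1-1,\ldots,c_n-1)$ over $\infty$ (plus simple points), and the set $\mathcal H_0(a,b;-c_1,\ldots,-c_n)$ of differentials on $\mathbb{CP}^1$ with zeros of orders $a,b$ and residueless poles of orders $c_1,\ldots,c_n$, up to $\mathrm{PGL}(2,\mathbb C)$. -/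
open Finset Polynomial

noncomputable section

/-- The residue at `z = t` of the differential `g(z) dz` for a rational function `g`. -/
def residueAt (t : ℂ) (g : RatFunc ℂ) : ℂ :=
  ((RatFunc.laurent t g : RatFunc ℂ) : LaurentSeries ℂ).coeff (-1)

/-- The derivative of a rational function. -/
def derivRF (g : RatFunc ℂ) : RatFunc ℂ :=
  (algebraMap (Polynomial ℂ) (RatFunc ℂ) (Polynomial.derivative g.num) *
      algebraMap (Polynomial ℂ) (RatFunc ℂ) g.denom -
    algebraMap (Polynomial ℂ) (RatFunc ℂ) g.num *
      algebraMap (Polynomial ℂ) (RatFunc ℂ) (Polynomial.derivative g.denom)) /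
    algebraMap (Polynomial ℂ) (RatFunc ℂ) (g.denom ^ 2)

/-- The orders for differentials of the first type: zeros of orders `a, b` at `z₁, z₂`,
residueless poles of orders `cⱼ` at `z_{2+j}`. -/
def multFirst (a b : ℕ) {n : ℕ} (c : Fin n → ℕ) : Fin (2 + n) → ℤ :=
  Fin.append ![(a : ℤ), (b : ℤ)] (fun j => -(c j : ℤ))

/-- The differential `ω_Z = ∏ᵢ (z - zᵢ)^(mᵢ) dz` associated to a configuration `Z`. -/
def omegaZ {N : ℕ} (m : Fin N → ℤ) (Z : Fin N → ℂ) : RatFunc ℂ :=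
  ∏ i, (RatFunc.X - RatFunc.C (Z i)) ^ (m i)

/-- `𝓗₀(a,b; -c₁,…,-cₙ)` before quotienting: configurations of pairwise distinct (finite)
points such that `ω_Z` has vanishing residues at `z₃, …, z_{n+2}`. -/
def H₀first (a b : ℕ) {n : ℕ} (c : Fin n → ℕ) : Type :=
  { Z : Fin (2 + n) → ℂ // Function.Injective Z ∧
      ∀ j : Fin n, residueAt (Z (Fin.natAdd 2 j)) (omegaZ (multFirst a b c) Z) = 0 }

/-- The `PGL(2,ℂ)`-equivalence of configurations. -/
def moebiusRelFirst (a b : ℕ) {n : ℕ} (c : Fin n → ℕ)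
    (Z W : H₀first a b c) : Prop :=
  ∃ p q r s : ℂ, p * s - q * r ≠ 0 ∧
    ∀ i, r * Z.val i + s ≠ 0 ∧ W.val i = (p * Z.val i + q) / (r * Z.val i + s)

/-- Ramified coverings of the relevant kind: rational functions `f` (normalized by
`f(z₁) = 0`, `f(z₂) = 1`), together with the configuration `Z` of their critical points,
such that `df = e ⬝ ∏ (z - zᵢ)^(mᵢ) dz` for some `e ≠ 0`; this encodes that `f` has
ramification profile `(a+1)` over `0` (at `z₁`), `(b+1)` over `1` (at `z₂`) and
`(c₁-1, …, cₙ-1)` over `∞` (at the poles `z₃, …, z_{n+2}`), plus simple points, and is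
unramified elsewhere; the degree of `f` is then `∑ cᵢ - n`. -/
def Cover (a b : ℕ) {n : ℕ} (c : Fin n → ℕ) : Type :=
  { p : RatFunc ℂ × (Fin (2 + n) → ℂ) // Function.Injective p.2 ∧
      (∃ e : ℂˣ, derivRF p.1 = RatFunc.C (e : ℂ) * omegaZ (multFirst a b c) p.2) ∧
      RatFunc.eval (RingHom.id ℂ) (p.2 ⟨0, by omega⟩) p.1 = 0 ∧
      RatFunc.eval (RingHom.id ℂ) (p.2 ⟨1, by omega⟩) p.1 = 1 }

/-- Isomorphism of ramified coverings of `ℂP¹` by `ℂP¹` (fixing the marked ramification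
points): precomposition with a Möbius transformation `φ` with `φ(wᵢ) = zᵢ`. -/
def coverRel (a b : ℕ) {n : ℕ} (c : Fin n → ℕ) (F G : Cover a b c) : Prop :=
  ∃ p q r s : ℂ, p * s - q * r ≠ 0 ∧
    (∀ i, r * G.val.2 i + s ≠ 0 ∧
      F.val.2 i = (p * G.val.2 i + q) / (r * G.val.2 i + s)) ∧
    G.val.1 = RatFunc.eval (algebraMap ℂ (RatFunc ℂ))
      ((RatFunc.C p * RatFunc.X + RatFunc.C q) / (RatFunc.C r * RatFunc.X + RatFunc.C s))
      F.val.1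

end

namespace RatFuncDeriv

lemma derivRF_div (p q : ℂ[X]) (hq : q ≠ 0) :
    derivRF (algebraMap ℂ[X] (RatFunc ℂ) p / algebraMap ℂ[X] (RatFunc ℂ) q) =
      algebraMap ℂ[X] (RatFunc ℂ) (derivative p * q - p * derivative q) /
        algebraMap ℂ[X] (RatFunc ℂ) (q ^ 2) := by
  set g := algebraMap ℂ[X] (RatFunc ℂ) p / algebraMap ℂ[X] (RatFunc ℂ) q with hg
  have hd : g.denom ≠ 0 := g.denom_ne_zero
  have h : g.num * q = p * g.denom := (RatFunc.num_mul_eq_mul_denom_iff hq).2 hg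
  have h' := congrArg derivative h
  simp only [derivative_mul] at h'
  have key : (derivative g.num * g.denom - g.num * derivative g.denom) * q ^ 2 =
      (derivative p * q - p * derivative q) * g.denom ^ 2 := by
    linear_combination (g.denom * q) * h' - (derivative g.denom * q + g.denom * derivative q) * h
  unfold derivRF
  rw [div_eq_div_iff]
  · rw [← map_mul, ← map_mul, ← map_sub, ← map_mul, ← map_mul, key]
  · simpa using hd
  · simpa using hq

lemma derivRF_add (f g : RatFunc ℂ) : derivRF (f + g) = derivRF f + derivRF g := by
  have hf : algebraMap ℂ[X] (RatFunc ℂ) f.denom ≠ 0 := by simpa using f.denom_ne_zero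
  have hg : algebraMap ℂ[X] (RatFunc ℂ) g.denom ≠ 0 := by simpa using g.denom_ne_zero
  conv_lhs => rw [← f.num_div_denom, ← g.num_div_denom, div_add_div _ _ hf hg, ← map_mul,
    ← map_mul, ← map_add, ← map_mul, derivRF_div _ _ (mul_ne_zero f.denom_ne_zero g.denom_ne_zero)]
  unfold derivRF
  simp only [derivative_mul, map_sub, map_mul, map_add, map_pow]
  field_simp
  ring

lemma derivRF_mul (f g : RatFunc ℂ) : derivRF (f * g) = f * derivRF g + g * derivRF f := by
  have hf : algebraMap ℂ[X] (RatFunc ℂ) f.denom ≠ 0 := by simpa using f.denom_ne_zero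
  have hg : algebraMap ℂ[X] (RatFunc ℂ) g.denom ≠ 0 := by simpa using g.denom_ne_zero
  conv_lhs => rw [← f.num_div_denom, ← g.num_div_denom, div_mul_div_comm, ← map_mul,
    ← map_mul, derivRF_div _ _ (mul_ne_zero f.denom_ne_zero g.denom_ne_zero)]
  conv_rhs => enter [1, 1]; rw [← f.num_div_denom]
  conv_rhs => enter [2, 1]; rw [← g.num_div_denom]
  unfold derivRF
  simp only [derivative_mul, map_sub, map_mul, map_add, map_pow]
  field_simp
  ring

lemma derivRF_algebraMap (p : ℂ[X]) :
    derivRF (algebraMap ℂ[X] (RatFunc ℂ) p) = algebraMap ℂ[X] (RatFunc ℂ) (derivative p) := by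
  simpa using derivRF_div p 1 one_ne_zero

lemma derivRF_C (r : ℂ) : derivRF (RatFunc.C r) = 0 := by
  rw [← RatFunc.algebraMap_C, derivRF_algebraMap]; simp

/-- `derivRF` as a `ℂ`-derivation of the field of rational functions. -/
noncomputable def derivRFDerivation : Derivation ℂ (RatFunc ℂ) (RatFunc ℂ) where
  toFun := derivRF
  map_add' := derivRF_add
  map_smul' r f := by
    simp [RatFunc.smul_eq_C_mul, derivRF_mul, derivRF_C]
  map_one_eq_zero' := by
    simpa using derivRF_C 1
  leibniz' f g := by simpa using derivRF_mul f g

@[simp] lemma derivRFDerivation_apply (f : RatFunc ℂ) : derivRFDerivation f = derivRF f := rfl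

lemma derivRF_C_mul (r : ℂ) (f : RatFunc ℂ) :
    derivRF (RatFunc.C r * f) = RatFunc.C r * derivRF f := by
  simp [derivRF_mul, derivRF_C]

lemma derivRF_sub (f g : RatFunc ℂ) : derivRF (f - g) = derivRF f - derivRF g :=
  map_sub derivRFDerivation f g

lemma derivRF_sum {ι : Type*} (s : Finset ι) (f : ι → RatFunc ℂ) :
    derivRF (∑ i ∈ s, f i) = ∑ i ∈ s, derivRF (f i) :=
  map_sum derivRFDerivation f s

lemma X_sub_C_ne_zero (t : ℂ) : (RatFunc.X - RatFunc.C t : RatFunc ℂ) ≠ 0 := by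
  rw [← RatFunc.algebraMap_X, ← RatFunc.algebraMap_C, ← map_sub]
  exact RatFunc.algebraMap_ne_zero (Polynomial.X_sub_C_ne_zero t)

lemma derivRF_X_sub_C_inv_pow (t : ℂ) (k : ℕ) :
    derivRF ((RatFunc.X - RatFunc.C t)⁻¹ ^ k) =
      RatFunc.C (-(k : ℂ)) * (RatFunc.X - RatFunc.C t)⁻¹ ^ (k + 1) := by
  have h1 : derivRF (RatFunc.X - RatFunc.C t) = 1 := by
    rw [← RatFunc.algebraMap_X, ← RatFunc.algebraMap_C, ← map_sub, derivRF_algebraMap]; simp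
  have := derivRFDerivation.leibniz_pow ((RatFunc.X - RatFunc.C t)⁻¹) k
  rw [derivRFDerivation.leibniz_inv] at this
  simp only [derivRFDerivation_apply, h1] at this
  rw [this]
  have hX := X_sub_C_ne_zero t
  rcases k with _ | k
  · simp
  · simp [pow_succ]
    ring

lemma eq_C_of_derivRF_eq_zero {f : RatFunc ℂ} (hf : derivRF f = 0) : ∃ k, f = RatFunc.C k := by
  have hd : f.denom ≠ 0 := f.denom_ne_zero
  have h : derivative f.num * f.denom = f.num * derivative f.denom := by
    unfold derivRF at hf
    rw [div_eq_zero_iff] at hf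
    rcases hf with hf | hf
    · rw [← map_mul, ← map_mul, ← map_sub] at hf
      exact sub_eq_zero.1 ((map_eq_zero_iff _ (RatFunc.algebraMap_injective ℂ)).1 hf)
    · simp [hd] at hf
  have hdvd : f.denom ∣ derivative f.denom :=
    (f.isCoprime_num_denom.symm).dvd_of_dvd_mul_left ⟨derivative f.num, by rw [← h]; ring⟩
  have hd0 : derivative f.denom = 0 := by
    by_contra h0
    exact absurd (degree_le_of_dvd hdvd h0) (not_le.2 (degree_derivative_lt hd))
  have hn0 : derivative f.num = 0 := by
    rw [hd0, mul_zero] at h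
    exact (mul_eq_zero.1 h).resolve_right hd
  obtain ⟨u, hu⟩ : ∃ u, f.denom = C u := ⟨_, eq_C_of_derivative_eq_zero hd0⟩
  obtain ⟨v, hv⟩ : ∃ v, f.num = C v := ⟨_, eq_C_of_derivative_eq_zero hn0⟩
  refine ⟨v / u, ?_⟩
  conv_lhs => rw [← f.num_div_denom, hu, hv]
  simp

/-! ### Residues -/

section LaurentExpansion

variable {F : Type*} [Field F]

open scoped RatFunc in
/-- The Laurent expansion of a rational function at `t`. -/
noncomputable def laurentExpansion (t : F) : RatFunc F →+* LaurentSeries F :=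
  (algebraMap (RatFunc F) (LaurentSeries F)).comp (RatFunc.laurent t).toRingHom

open scoped RatFunc in
lemma laurentExpansion_algebraMap (t : F) (p : F[X]) :
    laurentExpansion t (algebraMap F[X] (RatFunc F) p) =
      HahnSeries.ofPowerSeries ℤ F ((taylor t p : F[X]) : PowerSeries F) := by
  exact (congrArg (algebraMap (RatFunc F) (LaurentSeries F))
    (RatFunc.laurent_algebraMap t p)).trans (RatFunc.coe_coe _).symm

lemma laurentExpansion_X_sub_C (t u : F) :
    laurentExpansion t (RatFunc.X - RatFunc.C u) =
      HahnSeries.ofPowerSeries ℤ F (PowerSeries.X + PowerSeries.C (t - u)) := by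
  rw [← RatFunc.algebraMap_X, ← RatFunc.algebraMap_C, ← map_sub, laurentExpansion_algebraMap]
  congr 1
  simp
  ring

lemma laurentExpansion_C (t r : F) :
    laurentExpansion t (RatFunc.C r) = HahnSeries.C r := by
  rw [← RatFunc.algebraMap_C, laurentExpansion_algebraMap]
  simp

lemma laurentExpansion_inv_pow_of_ne {t u : F} (h : t ≠ u) (k : ℕ) :
    laurentExpansion t ((RatFunc.X - RatFunc.C u)⁻¹ ^ k) =
      HahnSeries.ofPowerSeries ℤ F ((PowerSeries.X + PowerSeries.C (t - u))⁻¹ ^ k) := by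
  have h1 : (PowerSeries.X + PowerSeries.C (t - u) : PowerSeries F) *
      (PowerSeries.X + PowerSeries.C (t - u))⁻¹ = 1 :=
    PowerSeries.mul_inv_cancel _ (by simpa [sub_eq_zero] using h)
  rw [map_pow, map_inv₀, laurentExpansion_X_sub_C, map_pow]
  congr 1
  exact inv_eq_of_mul_eq_one_right (by rw [← map_mul, h1, map_one])

lemma laurentExpansion_inv_pow_self (t : F) (k : ℕ) :
    laurentExpansion t ((RatFunc.X - RatFunc.C t)⁻¹ ^ k) =
      HahnSeries.single (-(k : ℤ)) (1 : F) := by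
  rw [map_pow, map_inv₀, laurentExpansion_X_sub_C]
  simp

end LaurentExpansion

lemma residueAt_eq_coeff (t : ℂ) (f : RatFunc ℂ) :
    residueAt t f = (laurentExpansion t f).coeff (-1) := rfl

lemma residueAt_add (t : ℂ) (f g : RatFunc ℂ) :
    residueAt t (f + g) = residueAt t f + residueAt t g := by
  simp only [residueAt_eq_coeff, map_add, HahnSeries.coeff_add]

lemma residueAt_C_mul (t r : ℂ) (f : RatFunc ℂ) :
    residueAt t (RatFunc.C r * f) = r * residueAt t f := by
  rw [residueAt_eq_coeff, map_mul, laurentExpansion_C, HahnSeries.C_mul_eq_smul,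
    HahnSeries.coeff_smul, residueAt_eq_coeff, smul_eq_mul]

lemma residueAt_sum {ι : Type*} (t : ℂ) (s : Finset ι) (f : ι → RatFunc ℂ) :
    residueAt t (∑ i ∈ s, f i) = ∑ i ∈ s, residueAt t (f i) := by
  classical
  induction s using Finset.induction_on with
  | empty => simp only [residueAt_eq_coeff, Finset.sum_empty, map_zero, HahnSeries.coeff_zero]
  | insert a s ha ih => rw [Finset.sum_insert ha, Finset.sum_insert ha, residueAt_add, ih]

lemma residueAt_algebraMap (t : ℂ) (p : ℂ[X]) :
    residueAt t (algebraMap ℂ[X] (RatFunc ℂ) p) = 0 := by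
  rw [residueAt_eq_coeff, laurentExpansion_algebraMap, PowerSeries.coeff_coe]
  simp

lemma residueAt_inv_pow_of_ne {t u : ℂ} (h : t ≠ u) (k : ℕ) :
    residueAt t ((RatFunc.X - RatFunc.C u)⁻¹ ^ k) = 0 := by
  rw [residueAt_eq_coeff, laurentExpansion_inv_pow_of_ne h, PowerSeries.coeff_coe]
  simp

lemma residueAt_inv_pow_self (t : ℂ) (k : ℕ) :
    residueAt t ((RatFunc.X - RatFunc.C t)⁻¹ ^ k) = if k = 1 then 1 else 0 := by
  rw [residueAt_eq_coeff, laurentExpansion_inv_pow_self, HahnSeries.coeff_single]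
  congr 1
  simp [eq_comm]

/-- Partial fraction decomposition over `ℂ`. -/
lemma exists_partialFractions (s : Finset ℂ) (n : ℂ → ℕ) (p : ℂ[X]) :
    ∃ (q : ℂ[X]) (r : ∀ t : ℂ, Fin (n t) → ℂ),
      algebraMap ℂ[X] (RatFunc ℂ) p * ∏ t ∈ s, (RatFunc.X - RatFunc.C t)⁻¹ ^ n t =
        algebraMap ℂ[X] (RatFunc ℂ) q + ∑ t ∈ s, ∑ j : Fin (n t),
          RatFunc.C (r t j) * (RatFunc.X - RatFunc.C t)⁻¹ ^ (j.1 + 1) := by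
  obtain ⟨q, r, hr, h⟩ := mul_prod_pow_inverse_eq_quo_add_sum_rem_mul_pow_inverse
    (K := RatFunc ℂ) (s := s) p (g := fun t => X - C t) (fun t _ => monic_X_sub_C t)
    (fun t _ u _ htu => isCoprime_X_sub_C_of_isUnit_sub (sub_ne_zero.2 htu).isUnit) n
    (gi := fun t => (RatFunc.X - RatFunc.C t)⁻¹)
    (fun t _ => by
      rw [map_sub, RatFunc.algebraMap_X, RatFunc.algebraMap_C]
      exact inv_mul_cancel₀ (X_sub_C_ne_zero t))
  refine ⟨q, fun t j => (r t j).coeff 0, h.trans ?_⟩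
  congr 1
  refine Finset.sum_congr rfl fun t ht => Finset.sum_congr rfl fun j _ => ?_
  have hdeg : (r t j).degree < 1 := by simpa using hr t ht j
  conv_lhs => rw [eq_C_of_degree_le_zero (Nat.WithBot.lt_one_iff_le_zero.1 hdeg)]
  rw [RatFunc.algebraMap_C]

lemma residueAt_derivRF (t : ℂ) (f : RatFunc ℂ) : residueAt t (derivRF f) = 0 := by
  classical
  have hfac : algebraMap ℂ[X] (RatFunc ℂ) f.num *
      ∏ u ∈ f.denom.roots.toFinset, (RatFunc.X - RatFunc.C u)⁻¹ ^ f.denom.roots.count u = f := by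
    have hsplit := (IsAlgClosed.splits f.denom).eq_prod_roots_of_monic f.monic_denom
    conv_rhs => rw [← f.num_div_denom, div_eq_mul_inv, hsplit]
    rw [Finset.prod_multiset_map_count, map_prod, ← Finset.prod_inv_distrib]
    simp
  obtain ⟨q, r, h⟩ := exists_partialFractions f.denom.roots.toFinset
    (fun u => f.denom.roots.count u) f.num
  rw [hfac] at h
  rw [h, derivRF_add, derivRF_algebraMap, derivRF_sum, residueAt_add, residueAt_algebraMap,
    residueAt_sum, zero_add]
  refine Finset.sum_eq_zero fun u _ => ?_
  rw [derivRF_sum, residueAt_sum]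
  refine Finset.sum_eq_zero fun j _ => ?_
  rw [derivRF_C_mul, derivRF_X_sub_C_inv_pow, residueAt_C_mul, residueAt_C_mul]
  rcases eq_or_ne t u with rfl | htu
  · rw [residueAt_inv_pow_self]; simp
  · rw [residueAt_inv_pow_of_ne htu]; simp

lemma exists_derivative_eq (q : ℂ[X]) : ∃ Q : ℂ[X], derivative Q = q := by
  induction q using Polynomial.induction_on' with
  | add p q hp hq =>
    obtain ⟨P, rfl⟩ := hp
    obtain ⟨Q, rfl⟩ := hq
    exact ⟨P + Q, derivative_add⟩
  | monomial k r =>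
    refine ⟨monomial (k + 1) (r / ((k : ℂ) + 1)), ?_⟩
    have : (k : ℂ) + 1 ≠ 0 := by exact_mod_cast k.succ_ne_zero
    rw [derivative_monomial]
    push_cast
    rw [div_mul_cancel₀ _ this]

/-- A rational function all of whose residues at the poles vanish has a primitive. -/
lemma exists_derivRF_eq (s : Finset ℂ) (n : ℂ → ℕ) (p : ℂ[X])
    (h : ∀ t ∈ s, residueAt t (algebraMap ℂ[X] (RatFunc ℂ) p *
      ∏ t ∈ s, (RatFunc.X - RatFunc.C t)⁻¹ ^ n t) = 0) :
    ∃ f, derivRF f = algebraMap ℂ[X] (RatFunc ℂ) p *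
      ∏ t ∈ s, (RatFunc.X - RatFunc.C t)⁻¹ ^ n t := by
  classical
  obtain ⟨q, r, hpf⟩ := exists_partialFractions s n p
  rw [hpf] at h ⊢
  obtain ⟨Q, hQ⟩ := exists_derivative_eq q
  have hres : ∀ t ∈ s, ∀ j : Fin (n t), j.1 = 0 → r t j = 0 := by
    intro t ht j hj
    have := h t ht
    rw [residueAt_add, residueAt_algebraMap, zero_add, residueAt_sum,
      Finset.sum_eq_single_of_mem t ht, residueAt_sum,
      Finset.sum_eq_single_of_mem j (Finset.mem_univ j), residueAt_C_mul,
      residueAt_inv_pow_self] at this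
    · simpa [hj] using this
    · intro i _ hij
      rw [residueAt_C_mul, residueAt_inv_pow_self, if_neg, mul_zero]
      intro hi
      exact hij (Fin.ext (by omega))
    · intro u _ hut
      rw [residueAt_sum]
      refine Finset.sum_eq_zero fun i _ => ?_
      rw [residueAt_C_mul, residueAt_inv_pow_of_ne hut.symm, mul_zero]
  refine ⟨algebraMap ℂ[X] (RatFunc ℂ) Q + ∑ t ∈ s, ∑ j : Fin (n t),
    RatFunc.C (-r t j / (j.1 : ℂ)) * (RatFunc.X - RatFunc.C t)⁻¹ ^ j.1, ?_⟩
  rw [derivRF_add, derivRF_algebraMap, hQ, derivRF_sum]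
  congr 1
  refine Finset.sum_congr rfl fun t ht => ?_
  rw [derivRF_sum]
  refine Finset.sum_congr rfl fun j _ => ?_
  rw [derivRF_C_mul, derivRF_X_sub_C_inv_pow, ← mul_assoc, ← map_mul]
  congr 2
  rcases eq_or_ne j.1 0 with hj | hj
  · simp [hres t ht j hj, hj]
  · have : (j.1 : ℂ) ≠ 0 := by exact_mod_cast hj
    field_simp

/-! ### Local structure of primitives -/

lemma exists_wronskian_eq_of_root {P Q R : ℂ[X]} {z : ℂ} {k : ℕ} (hP : P = (X - C z) ^ (k + 1) * R)
    (hR : R.eval z ≠ 0) (hQ : Q.eval z ≠ 0) :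
    ∃ S : ℂ[X], S.eval z ≠ 0 ∧
      derivative P * Q - P * derivative Q = (X - C z) ^ k * S := by
  refine ⟨C ((k : ℂ) + 1) * R * Q +
    (X - C z) * (derivative R * Q - R * derivative Q), ?_, ?_⟩
  · have : (k : ℂ) + 1 ≠ 0 := by exact_mod_cast k.succ_ne_zero
    simp [hR, hQ, this]
  · rw [hP, derivative_mul, derivative_X_sub_C_pow]
    simp only [Nat.add_sub_cancel, Nat.cast_add, Nat.cast_one, map_add, map_natCast, map_one]
    ring

lemma exists_eq_X_sub_C_pow_mul {P : ℂ[X]} (hP : P ≠ 0) (z : ℂ) :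
    ∃ R : ℂ[X], R.eval z ≠ 0 ∧ P = (X - C z) ^ (P.rootMultiplicity z) * R := by
  obtain ⟨R, hR, h⟩ := exists_eq_pow_rootMultiplicity_mul_and_not_dvd P hP z
  exact ⟨R, fun h0 => h (dvd_iff_isRoot.2 h0), hR⟩

lemma exponent_eq_of_X_sub_C_pow_mul_eq {z : ℂ} {i j : ℕ} {S T : ℂ[X]} (hS : S.eval z ≠ 0)
    (hT : T.eval z ≠ 0) (h : (X - C z) ^ i * S = (X - C z) ^ j * T) : i = j := by
  have key : ∀ {i : ℕ} {S : ℂ[X]}, S.eval z ≠ 0 →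
      rootMultiplicity z ((X - C z) ^ i * S) = i := by
    intro i S hS
    have hS0 : S ≠ 0 := by rintro rfl; simp at hS
    rw [rootMultiplicity_mul (mul_ne_zero (pow_ne_zero _ (Polynomial.X_sub_C_ne_zero z)) hS0),
      rootMultiplicity_X_sub_C_pow, rootMultiplicity_eq_zero hS, add_zero]
  exact (key hS).symm.trans ((congrArg _ h).trans (key hT))

lemma wronskian_mul_eq {f : RatFunc ℂ} {A B : ℂ[X]} (hB : B ≠ 0)
    (h : derivRF f = algebraMap ℂ[X] (RatFunc ℂ) A / algebraMap ℂ[X] (RatFunc ℂ) B) :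
    (derivative f.num * f.denom - f.num * derivative f.denom) * B = A * f.denom ^ 2 := by
  unfold derivRF at h
  have hd : f.denom ^ 2 ≠ 0 := pow_ne_zero 2 f.denom_ne_zero
  rw [div_eq_div_iff (RatFunc.algebraMap_ne_zero hd) (RatFunc.algebraMap_ne_zero hB)] at h
  exact RatFunc.algebraMap_injective ℂ (by simpa only [map_mul, map_sub] using h)

lemma num_eval_ne_zero_of_denom_eval_eq_zero {f : RatFunc ℂ} {z : ℂ} (h : f.denom.eval z = 0) :
    f.num.eval z ≠ 0 := by
  intro h0
  obtain ⟨u, v, huv⟩ := f.isCoprime_num_denom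
  simpa [h, h0] using congrArg (Polynomial.eval z) huv

/-- A primitive of `A / B` has a pole of order `c - 1` at a zero of `B` of order `c`, and no
pole outside the zeros of `B`. -/
lemma rootMultiplicity_denom_add_one {f : RatFunc ℂ} {A B T : ℂ[X]} {z : ℂ} {c : ℕ}
    (hB : B = (X - C z) ^ c * T) (hT : T.eval z ≠ 0)
    (h : derivRF f = algebraMap ℂ[X] (RatFunc ℂ) A / algebraMap ℂ[X] (RatFunc ℂ) B)
    (hz : f.denom.eval z = 0) (hA : A.eval z ≠ 0 ∨ c = 0) :
    f.denom.rootMultiplicity z + 1 = c := by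
  have hT0 : T ≠ 0 := by rintro rfl; simp at hT
  have hB0 : B ≠ 0 := hB ▸ mul_ne_zero (pow_ne_zero _ (Polynomial.X_sub_C_ne_zero z)) hT0
  have hW := wronskian_mul_eq hB0 h
  obtain ⟨R, hR, hQ⟩ := exists_eq_X_sub_C_pow_mul f.denom_ne_zero z
  obtain ⟨k, hk⟩ : ∃ k, f.denom.rootMultiplicity z = k + 1 :=
    Nat.exists_eq_succ_of_ne_zero
      ((rootMultiplicity_pos f.denom_ne_zero).2 hz).ne'
  rw [hk] at hQ
  obtain ⟨S, hS, hSW⟩ := exists_wronskian_eq_of_root hQ hR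
    (num_eval_ne_zero_of_denom_eval_eq_zero hz)
  have hmain : (X - C z) ^ (k + c) * (S * T) = (X - C z) ^ (2 * k + 2) * (-A * R ^ 2) := by
    have h1 : (derivative f.num * f.denom - f.num * derivative f.denom) =
        -((X - C z) ^ k * S) := by rw [← hSW]; ring
    rw [h1, hB] at hW
    calc (X - C z) ^ (k + c) * (S * T) = -(-((X - C z) ^ k * S) * ((X - C z) ^ c * T)) := by ring
      _ = -(A * ((X - C z) ^ (k + 1) * R) ^ 2) := by rw [hW]; congr 3
      _ = _ := by ring
  rcases hA with hA | rfl
  · have := exponent_eq_of_X_sub_C_pow_mul_eq (by simp [hS, hT]) (by simp [hA, hR]) hmain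
    omega
  · exfalso
    rw [add_zero, show 2 * k + 2 = k + (k + 2) by ring, pow_add, mul_assoc] at hmain
    have := mul_left_cancel₀ (pow_ne_zero _ (Polynomial.X_sub_C_ne_zero z)) hmain
    have := congrArg (Polynomial.eval z) this
    simp [hS, hT] at this

lemma denom_eval_ne_zero {f : RatFunc ℂ} {A B : ℂ[X]} {z : ℂ} (hB : B.eval z ≠ 0)
    (h : derivRF f = algebraMap ℂ[X] (RatFunc ℂ) A / algebraMap ℂ[X] (RatFunc ℂ) B) :
    f.denom.eval z ≠ 0 := fun hz => by
  have := rootMultiplicity_denom_add_one (c := 0) (by simp) hB h hz (Or.inr rfl)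
  omega

/-- If the differential `A / B` vanishes to order `a` at `z`, then any primitive vanishing at `z`
does so to order `a + 1`. -/
lemma X_sub_C_pow_dvd_num {f : RatFunc ℂ} {A B T : ℂ[X]} {z : ℂ} {a : ℕ} (hB : B.eval z ≠ 0)
    (hA : A = (X - C z) ^ a * T) (hT : T.eval z ≠ 0)
    (h : derivRF f = algebraMap ℂ[X] (RatFunc ℂ) A / algebraMap ℂ[X] (RatFunc ℂ) B)
    (hf : f.num ≠ 0) (hz : f.num.eval z = 0) : (X - C z) ^ (a + 1) ∣ f.num := by
  have hB0 : B ≠ 0 := by rintro rfl; simp at hB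
  have hd := denom_eval_ne_zero hB h
  obtain ⟨R, hR, hP⟩ := exists_eq_X_sub_C_pow_mul hf z
  obtain ⟨k, hk⟩ : ∃ k, f.num.rootMultiplicity z = k + 1 :=
    Nat.exists_eq_succ_of_ne_zero ((rootMultiplicity_pos hf).2 hz).ne'
  rw [hk] at hP
  obtain ⟨S, hS, hSW⟩ := exists_wronskian_eq_of_root hP hR hd
  have hW := wronskian_mul_eq hB0 h
  rw [hSW, hA, mul_assoc, mul_assoc] at hW
  have := exponent_eq_of_X_sub_C_pow_mul_eq (by simp [hS, hB]) (by simp [hT, hd]) hW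
  subst this
  exact ⟨R, hP⟩

lemma le_natDegree_wronskian {P Q : ℂ[X]} (hQ : Q ≠ 0) (h : Q.natDegree < P.natDegree) :
    P.natDegree + Q.natDegree ≤ (derivative P * Q - P * derivative Q).natDegree + 1 := by
  have hP : P ≠ 0 := by rintro rfl; simp at h
  obtain ⟨p, hp⟩ : ∃ p, P.natDegree = p + 1 := ⟨P.natDegree - 1, by omega⟩
  suffices hc : (derivative P * Q - P * derivative Q).coeff (p + Q.natDegree) ≠ 0 by
    have := le_natDegree_of_ne_zero hc
    omega
  have h1 : (derivative P * Q).coeff (p + Q.natDegree) =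
      P.leadingCoeff * (p + 1) * Q.leadingCoeff := by
    rw [coeff_mul_add_eq_of_natDegree_le ((natDegree_derivative_le P).trans (by omega)) le_rfl,
      coeff_derivative, ← hp]
    rfl
  have h2 : (P * derivative Q).coeff (p + Q.natDegree) =
      P.leadingCoeff * (Q.natDegree * Q.leadingCoeff) := by
    rcases Nat.eq_zero_or_pos Q.natDegree with hq | hq
    · rw [eq_C_of_natDegree_eq_zero hq]; simp
    · obtain ⟨q, hq⟩ : ∃ q, Q.natDegree = q + 1 := ⟨Q.natDegree - 1, by omega⟩
      rw [hq, show p + (q + 1) = (p + 1) + q by ring,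
        coeff_mul_add_eq_of_natDegree_le hp.le ((natDegree_derivative_le Q).trans (by omega)),
        coeff_derivative, ← hp, leadingCoeff, leadingCoeff, hq]
      push_cast
      ring
  rw [coeff_sub, h1, h2]
  have hne : ((p : ℂ) + 1 - Q.natDegree) ≠ 0 := by
    rw [sub_ne_zero]
    exact_mod_cast (by omega : p + 1 ≠ Q.natDegree)
  have : P.leadingCoeff * (p + 1) * Q.leadingCoeff -
      P.leadingCoeff * (Q.natDegree * Q.leadingCoeff) =
      P.leadingCoeff * Q.leadingCoeff * ((p : ℂ) + 1 - Q.natDegree) := by ring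
  rw [this]
  exact mul_ne_zero (mul_ne_zero (leadingCoeff_ne_zero.2 hP) (leadingCoeff_ne_zero.2 hQ)) hne

/-! ### Values of rational functions -/

/-- The rational function `g` is regular at `z` with value `v`. -/
def HasValue (z : ℂ) (g : RatFunc ℂ) (v : ℂ) : Prop :=
  ∃ P Q : ℂ[X], Q.eval z ≠ 0 ∧
    g = algebraMap ℂ[X] (RatFunc ℂ) P / algebraMap ℂ[X] (RatFunc ℂ) Q ∧
    v = P.eval z / Q.eval z

lemma hasValue_eval {z : ℂ} {g : RatFunc ℂ} (h : g.denom.eval z ≠ 0) :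
    HasValue z g (RatFunc.eval (RingHom.id ℂ) z g) :=
  ⟨g.num, g.denom, h, g.num_div_denom.symm, rfl⟩

namespace HasValue

variable {z v w : ℂ} {g k : RatFunc ℂ}

lemma num_mul_eq (h : HasValue z g v) :
    g.denom.eval z ≠ 0 ∧ g.num.eval z = v * g.denom.eval z := by
  obtain ⟨P, Q, hQ, hg, rfl⟩ := h
  have hQ0 : Q ≠ 0 := by rintro rfl; simp at hQ
  have hd : g.denom.eval z ≠ 0 := by
    intro h0
    obtain ⟨R, hR⟩ : g.denom ∣ Q := hg ▸ RatFunc.denom_div_dvd P Q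
    rw [hR, eval_mul, h0, zero_mul] at hQ
    exact hQ rfl
  refine ⟨hd, ?_⟩
  have := congrArg (Polynomial.eval z) ((RatFunc.num_mul_eq_mul_denom_iff hQ0).2 hg)
  rw [eval_mul, eval_mul] at this
  field_simp
  exact this

lemma eval_eq (h : HasValue z g v) : RatFunc.eval (RingHom.id ℂ) z g = v := by
  obtain ⟨hd, hn⟩ := h.num_mul_eq
  change g.num.eval z / g.denom.eval z = v
  rw [hn, mul_div_cancel_right₀ _ hd]

lemma const (z r : ℂ) : HasValue z (RatFunc.C r) r := ⟨C r, 1, by simp, by simp, by simp⟩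

lemma add (hg : HasValue z g v) (hk : HasValue z k w) : HasValue z (g + k) (v + w) := by
  obtain ⟨P, Q, hQ, rfl, rfl⟩ := hg
  obtain ⟨P', Q', hQ', rfl, rfl⟩ := hk
  have hQ0 : Q ≠ 0 := by rintro rfl; simp at hQ
  have hQ0' : Q' ≠ 0 := by rintro rfl; simp at hQ'
  refine ⟨P * Q' + Q * P', Q * Q', by simp [hQ, hQ'], ?_, ?_⟩
  · rw [div_add_div _ _ (RatFunc.algebraMap_ne_zero hQ0) (RatFunc.algebraMap_ne_zero hQ0')]
    simp only [map_mul, map_add]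
  · rw [div_add_div _ _ hQ hQ']; simp

lemma mul (hg : HasValue z g v) (hk : HasValue z k w) : HasValue z (g * k) (v * w) := by
  obtain ⟨P, Q, hQ, rfl, rfl⟩ := hg
  obtain ⟨P', Q', hQ', rfl, rfl⟩ := hk
  refine ⟨P * P', Q * Q', by simp [hQ, hQ'], ?_, ?_⟩
  · rw [div_mul_div_comm, map_mul, map_mul]
  · rw [div_mul_div_comm, eval_mul, eval_mul]

lemma inv (hg : HasValue z g v) (hv : v ≠ 0) : HasValue z g⁻¹ v⁻¹ := by
  obtain ⟨P, Q, hQ, rfl, rfl⟩ := hg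
  have hP : P.eval z ≠ 0 := fun h => hv (by simp [h])
  exact ⟨Q, P, hP, by simp, by simp⟩

lemma sub (hg : HasValue z g v) (hk : HasValue z k w) : HasValue z (g - k) (v - w) := by
  have h1 : g - k = g + RatFunc.C (-1) * k := by simp [sub_eq_add_neg]
  have h2 : v - w = v + -1 * w := by ring
  rw [h1, h2]
  exact hg.add ((const z (-1)).mul hk)

lemma aeval (hg : HasValue z g v) (P : ℂ[X]) :
    HasValue z (Polynomial.aeval g P) (P.eval v) := by
  induction P using Polynomial.induction_on' with
  | add P Q hP hQ => simpa using hP.add hQ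
  | monomial k r =>
    have hpow : HasValue z (g ^ k) (v ^ k) := by
      induction k with
      | zero => simpa using const z 1
      | succ k ih => simpa only [pow_succ] using ih.mul hg
    simpa [aeval_monomial, RatFunc.algebraMap_eq_C] using (const z r).mul hpow

end HasValue

/-! ### The differential of a configuration and its primitives -/

section Configuration

variable {a b n : ℕ} {c : Fin n → ℕ} {Z : Fin (2 + n) → ℂ}

/-- The numerator of the differential of a configuration. -/
noncomputable def zerosPoly (a b : ℕ) {n : ℕ} (Z : Fin (2 + n) → ℂ) : ℂ[X] :=
  (X - C (Z (Fin.castAdd n 0))) ^ a * (X - C (Z (Fin.castAdd n 1))) ^ b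

/-- The denominator of the differential of a configuration. -/
noncomputable def polesPoly {n : ℕ} (c : Fin n → ℕ) (Z : Fin (2 + n) → ℂ) : ℂ[X] :=
  ∏ j, (X - C (Z (Fin.natAdd 2 j))) ^ c j

lemma omegaZ_eq_mul_prod (a b : ℕ) (c : Fin n → ℕ) (Z : Fin (2 + n) → ℂ) :
    omegaZ (multFirst a b c) Z = algebraMap ℂ[X] (RatFunc ℂ) (zerosPoly a b Z) *
      ∏ j, (RatFunc.X - RatFunc.C (Z (Fin.natAdd 2 j)))⁻¹ ^ c j := by
  unfold omegaZ multFirst zerosPoly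
  rw [Fin.prod_univ_add, Fin.prod_univ_two]
  simp only [Fin.append_left, Fin.append_right, map_mul, map_pow, map_sub, RatFunc.algebraMap_X,
    RatFunc.algebraMap_C, Matrix.cons_val_zero, Matrix.cons_val_one, zpow_natCast, zpow_neg,
    inv_pow]

lemma omegaZ_eq_div (a b : ℕ) (c : Fin n → ℕ) (Z : Fin (2 + n) → ℂ) :
    omegaZ (multFirst a b c) Z = algebraMap ℂ[X] (RatFunc ℂ) (zerosPoly a b Z) /
      algebraMap ℂ[X] (RatFunc ℂ) (polesPoly c Z) := by
  rw [omegaZ_eq_mul_prod, div_eq_mul_inv, polesPoly, map_prod, ← Finset.prod_inv_distrib]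
  simp

lemma C_mul_omegaZ_eq_div (e : ℂ) :
    RatFunc.C e * omegaZ (multFirst a b c) Z =
      algebraMap ℂ[X] (RatFunc ℂ) (C e * zerosPoly a b Z) /
        algebraMap ℂ[X] (RatFunc ℂ) (polesPoly c Z) := by
  rw [omegaZ_eq_div, map_mul, RatFunc.algebraMap_C, mul_div_assoc]

lemma polesPoly_ne_zero (c : Fin n → ℕ) (Z : Fin (2 + n) → ℂ) : polesPoly c Z ≠ 0 :=
  Finset.prod_ne_zero_iff.2 fun _ _ => pow_ne_zero _ (Polynomial.X_sub_C_ne_zero _)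

lemma zerosPoly_ne_zero (a b : ℕ) (Z : Fin (2 + n) → ℂ) : zerosPoly a b Z ≠ 0 :=
  mul_ne_zero (pow_ne_zero _ (Polynomial.X_sub_C_ne_zero _))
    (pow_ne_zero _ (Polynomial.X_sub_C_ne_zero _))

lemma omegaZ_ne_zero (a b : ℕ) (c : Fin n → ℕ) (Z : Fin (2 + n) → ℂ) :
    omegaZ (multFirst a b c) Z ≠ 0 := by
  rw [omegaZ_eq_div]
  exact div_ne_zero (RatFunc.algebraMap_ne_zero (zerosPoly_ne_zero a b Z))
    (RatFunc.algebraMap_ne_zero (polesPoly_ne_zero c Z))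

lemma natDegree_polesPoly (c : Fin n → ℕ) (Z : Fin (2 + n) → ℂ) :
    (polesPoly c Z).natDegree = ∑ j, c j := by
  rw [polesPoly, natDegree_prod_of_monic _ _ fun j _ => (monic_X_sub_C _).pow _]
  simp

lemma natDegree_zerosPoly (a b : ℕ) (Z : Fin (2 + n) → ℂ) :
    (zerosPoly a b Z).natDegree = a + b := by
  rw [zerosPoly, ((monic_X_sub_C _).pow _).natDegree_mul ((monic_X_sub_C _).pow _)]
  simp

lemma polesPoly_eval_ne_zero (hZ : Function.Injective Z) (c : Fin n → ℕ) (i : Fin 2) :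
    (polesPoly c Z).eval (Z (Fin.castAdd n i)) ≠ 0 := by
  rw [polesPoly, eval_prod]
  refine Finset.prod_ne_zero_iff.2 fun j _ => ?_
  rw [eval_pow, eval_sub, eval_X, eval_C]
  refine pow_ne_zero _ (sub_ne_zero.2 fun h => ?_)
  have := congrArg Fin.val (hZ h)
  simp at this
  omega

lemma zerosPoly_eval_ne_zero (hZ : Function.Injective Z) (a b : ℕ) (j : Fin n) :
    (zerosPoly a b Z).eval (Z (Fin.natAdd 2 j)) ≠ 0 := by
  have h : ∀ i : Fin 2, Z (Fin.natAdd 2 j) - Z (Fin.castAdd n i) ≠ 0 := fun i =>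
    sub_ne_zero.2 fun h => by
      have := congrArg Fin.val (hZ h)
      simp at this
      omega
  rw [zerosPoly]
  simp only [eval_mul, eval_pow, eval_sub, eval_X, eval_C]
  exact mul_ne_zero (pow_ne_zero _ (h 0)) (pow_ne_zero _ (h 1))

lemma denom_eval_castAdd_ne_zero (hZ : Function.Injective Z) {f : RatFunc ℂ} {e : ℂ}
    (hf : derivRF f = RatFunc.C e * omegaZ (multFirst a b c) Z) (i : Fin 2) :
    f.denom.eval (Z (Fin.castAdd n i)) ≠ 0 := by
  rw [C_mul_omegaZ_eq_div] at hf
  exact denom_eval_ne_zero (polesPoly_eval_ne_zero hZ c i) hf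

lemma natDegree_denom_le (hZ : Function.Injective Z) {f : RatFunc ℂ} {e : ℂ} (he : e ≠ 0)
    (hf : derivRF f = RatFunc.C e * omegaZ (multFirst a b c) Z) :
    f.denom.natDegree ≤ ∑ j, (c j - 1) := by
  classical
  rw [C_mul_omegaZ_eq_div] at hf
  have hinj : Function.Injective fun j : Fin n => Z (Fin.natAdd 2 j) :=
    hZ.comp (Fin.natAdd_injective n 2)
  have hcount : ∀ j, f.denom.roots.count (Z (Fin.natAdd 2 j)) ≤ c j - 1 := by
    intro j
    rw [count_roots]
    by_cases hz : f.denom.eval (Z (Fin.natAdd 2 j)) = 0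
    · have hfac : polesPoly c Z = (X - C (Z (Fin.natAdd 2 j))) ^ c j *
          ∏ k ∈ Finset.univ.erase j, (X - C (Z (Fin.natAdd 2 k))) ^ c k :=
        (Finset.mul_prod_erase Finset.univ
          (fun k => (X - C (Z (Fin.natAdd 2 k))) ^ c k) (Finset.mem_univ j)).symm
      have hT : (∏ k ∈ Finset.univ.erase j, (X - C (Z (Fin.natAdd 2 k))) ^ c k).eval
          (Z (Fin.natAdd 2 j)) ≠ 0 := by
        rw [eval_prod]
        refine Finset.prod_ne_zero_iff.2 fun k hk => ?_
        rw [eval_pow, eval_sub, eval_X, eval_C]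
        exact pow_ne_zero _ (sub_ne_zero.2 fun h => (Finset.mem_erase.1 hk).1 (hinj h).symm)
      have hA : (C e * zerosPoly a b Z).eval (Z (Fin.natAdd 2 j)) ≠ 0 := by
        rw [eval_mul, eval_C]
        exact mul_ne_zero he (zerosPoly_eval_ne_zero hZ a b j)
      generalize (∏ k ∈ Finset.univ.erase j, (X - C (Z (Fin.natAdd 2 k))) ^ c k) = T at hfac hT
      exact Nat.le_sub_of_add_le (rootMultiplicity_denom_add_one hfac hT hf hz (Or.inl hA)).le
    · rw [rootMultiplicity_eq_zero hz]
      exact Nat.zero_le _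
  have hsub : f.denom.roots.toFinset ⊆ Finset.univ.image fun j => Z (Fin.natAdd 2 j) := by
    intro z hz
    have hz0 : f.denom.eval z = 0 := isRoot_of_mem_roots (Multiset.mem_toFinset.1 hz)
    have hB : (polesPoly c Z).eval z = 0 := by
      by_contra hB
      exact denom_eval_ne_zero hB hf hz0
    rw [polesPoly, eval_prod, Finset.prod_eq_zero_iff] at hB
    obtain ⟨j, -, hj⟩ := hB
    rw [eval_pow, eval_sub, eval_X, eval_C] at hj
    exact Finset.mem_image.2
      ⟨j, Finset.mem_univ j, (sub_eq_zero.1 (eq_zero_of_pow_eq_zero hj)).symm⟩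
  rw [(IsAlgClosed.splits f.denom).natDegree_eq_card_roots, ← Multiset.toFinset_sum_count_eq]
  calc ∑ z ∈ f.denom.roots.toFinset, f.denom.roots.count z
      ≤ ∑ z ∈ Finset.univ.image (fun j => Z (Fin.natAdd 2 j)), f.denom.roots.count z :=
        Finset.sum_le_sum_of_subset hsub
    _ = ∑ j, f.denom.roots.count (Z (Fin.natAdd 2 j)) :=
        Finset.sum_image fun _ _ _ _ h => hinj h
    _ ≤ ∑ j, (c j - 1) := Finset.sum_le_sum fun j _ => hcount j

/-- A primitive of the differential of a configuration takes distinct values at the two zeros. -/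
lemma value_ne_value (hn : 1 ≤ n) (hc : ∀ i, 2 ≤ c i) (hsum : a + b + 2 = ∑ i, c i)
    (hZ : Function.Injective Z) {f : RatFunc ℂ} {e : ℂ} (he : e ≠ 0)
    (hf : derivRF f = RatFunc.C e * omegaZ (multFirst a b c) Z) {v w : ℂ}
    (h₀ : HasValue (Z (Fin.castAdd n 0)) f v) (h₁ : HasValue (Z (Fin.castAdd n 1)) f w) :
    v ≠ w := by
  rintro rfl
  set g := f - RatFunc.C v with hg
  have hdg : derivRF g = RatFunc.C e * omegaZ (multFirst a b c) Z := by
    rw [hg, derivRF_sub, derivRF_C, sub_zero, hf]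
  have hdeg := natDegree_denom_le hZ he hdg
  have hzero : ∀ {z : ℂ}, HasValue z f v → g.num.eval z = 0 := fun h => by
    have := (h.sub (HasValue.const _ v)).num_mul_eq.2
    rwa [sub_self, zero_mul] at this
  have hnum : g.num ≠ 0 := by
    intro h
    rw [RatFunc.num_eq_zero_iff.1 h, ← map_zero RatFunc.C, derivRF_C] at hdg
    exact mul_ne_zero (by simpa using he) (omegaZ_ne_zero a b c Z) hdg.symm
  rw [C_mul_omegaZ_eq_div] at hdg
  have h01 : Z (Fin.castAdd n 0) ≠ Z (Fin.castAdd n 1) := fun h => by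
    simpa using congrArg Fin.val (hZ h)
  have hd0 : (X - C (Z (Fin.castAdd n 0))) ^ (a + 1) ∣ g.num :=
    X_sub_C_pow_dvd_num (T := C e * (X - C (Z (Fin.castAdd n 1))) ^ b)
      (polesPoly_eval_ne_zero hZ c 0) (by rw [zerosPoly]; ring)
      (by simpa [he] using fun h => absurd (sub_eq_zero.1 h) h01) hdg hnum (hzero h₀)
  have hd1 : (X - C (Z (Fin.castAdd n 1))) ^ (b + 1) ∣ g.num :=
    X_sub_C_pow_dvd_num (T := C e * (X - C (Z (Fin.castAdd n 0))) ^ a)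
      (polesPoly_eval_ne_zero hZ c 1) (by rw [zerosPoly]; ring)
      (by simpa [he] using fun h => absurd (sub_eq_zero.1 h) h01.symm) hdg hnum (hzero h₁)
  have hdvd := (isCoprime_X_sub_C_of_isUnit_sub
    (sub_ne_zero.2 h01).isUnit).pow.mul_dvd hd0 hd1
  have hP : a + b + 2 ≤ g.num.natDegree := by
    have := natDegree_le_of_dvd hdvd hnum
    rw [((monic_X_sub_C _).pow _).natDegree_mul ((monic_X_sub_C _).pow _)] at this
    simp only [natDegree_pow, natDegree_X_sub_C, mul_one] at this
    omega
  have hlt : ∑ j, (c j - 1) < ∑ j, c j :=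
    Finset.sum_lt_sum_of_nonempty ⟨⟨0, hn⟩, Finset.mem_univ _⟩ fun j _ => by
      have := hc j
      omega
  have hQ := g.denom_ne_zero
  have hW := le_natDegree_wronskian hQ (show g.denom.natDegree < g.num.natDegree by omega)
  have hEq := wronskian_mul_eq (polesPoly_ne_zero c Z) hdg
  have hA : C e * zerosPoly a b Z ≠ 0 :=
    mul_ne_zero (by simpa using he) (zerosPoly_ne_zero a b Z)
  have hWne : derivative g.num * g.denom - g.num * derivative g.denom ≠ 0 := by
    intro h
    rw [h, zero_mul] at hEq
    exact mul_ne_zero hA (pow_ne_zero 2 hQ) hEq.symm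
  have hdegs := congrArg natDegree hEq
  rw [natDegree_mul hWne (polesPoly_ne_zero c Z), natDegree_mul hA (pow_ne_zero 2 hQ),
    natDegree_C_mul he, natDegree_zerosPoly, natDegree_polesPoly, natDegree_pow] at hdegs
  omega

lemma exists_primitive (hZ : Function.Injective Z)
    (hres : ∀ j : Fin n, residueAt (Z (Fin.natAdd 2 j)) (omegaZ (multFirst a b c) Z) = 0) :
    ∃ f, derivRF f = omegaZ (multFirst a b c) Z := by
  classical
  have hinj : Function.Injective fun j : Fin n => Z (Fin.natAdd 2 j) :=
    hZ.comp (Fin.natAdd_injective n 2)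
  have hω : omegaZ (multFirst a b c) Z = algebraMap ℂ[X] (RatFunc ℂ) (zerosPoly a b Z) *
      ∏ t ∈ Finset.univ.image (fun j => Z (Fin.natAdd 2 j)), (RatFunc.X - RatFunc.C t)⁻¹ ^
        Function.extend (fun j => Z (Fin.natAdd 2 j)) c 0 t := by
    rw [omegaZ_eq_mul_prod, Finset.prod_image fun _ _ _ _ h => hinj h]
    congr 1
    exact Finset.prod_congr rfl fun j _ => by rw [hinj.extend_apply]
  rw [hω] at hres ⊢
  refine exists_derivRF_eq _ _ _ fun t ht => ?_
  obtain ⟨j, -, rfl⟩ := Finset.mem_image.1 ht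
  exact hres j

lemma exists_normalized_primitive (hn : 1 ≤ n) (hc : ∀ i, 2 ≤ c i)
    (hsum : a + b + 2 = ∑ i, c i) (hZ : Function.Injective Z)
    (hres : ∀ j : Fin n, residueAt (Z (Fin.natAdd 2 j)) (omegaZ (multFirst a b c) Z) = 0) :
    ∃ f : RatFunc ℂ, (∃ e : ℂˣ, derivRF f = RatFunc.C (e : ℂ) * omegaZ (multFirst a b c) Z) ∧
      HasValue (Z (Fin.castAdd n 0)) f 0 ∧ HasValue (Z (Fin.castAdd n 1)) f 1 := by
  obtain ⟨f, hf⟩ := exists_primitive hZ hres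
  have hf' : derivRF f = RatFunc.C 1 * omegaZ (multFirst a b c) Z := by rw [hf]; simp
  have h₀ := hasValue_eval (denom_eval_castAdd_ne_zero hZ hf' 0)
  have h₁ := hasValue_eval (denom_eval_castAdd_ne_zero hZ hf' 1)
  set v := RatFunc.eval (RingHom.id ℂ) (Z (Fin.castAdd n 0)) f
  set w := RatFunc.eval (RingHom.id ℂ) (Z (Fin.castAdd n 1)) f
  have hvw : w - v ≠ 0 :=
    sub_ne_zero.2 (value_ne_value hn hc hsum hZ one_ne_zero hf' h₀ h₁).symm
  refine ⟨RatFunc.C (w - v)⁻¹ * (f - RatFunc.C v),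
    ⟨Units.mk0 _ (inv_ne_zero hvw), ?_⟩, ?_, ?_⟩
  · rw [derivRF_C_mul, derivRF_sub, derivRF_C, sub_zero, hf, Units.val_mk0]
  · simpa using (HasValue.const _ (w - v)⁻¹).mul (h₀.sub (HasValue.const _ v))
  · simpa [inv_mul_cancel₀ hvw] using
      (HasValue.const _ (w - v)⁻¹).mul (h₁.sub (HasValue.const _ v))

lemma normalized_primitive_unique {f g : RatFunc ℂ} {e d : ℂ} {z w : ℂ} {ω : RatFunc ℂ}
    (he : e ≠ 0) (hf : derivRF f = RatFunc.C e * ω) (hg : derivRF g = RatFunc.C d * ω)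
    (hf₀ : HasValue z f 0) (hg₀ : HasValue z g 0) (hf₁ : HasValue w f 1)
    (hg₁ : HasValue w g 1) : f = g := by
  obtain ⟨k, hk⟩ := eq_C_of_derivRF_eq_zero
    (f := RatFunc.C d * f - RatFunc.C e * g)
    (by rw [derivRF_sub, derivRF_C_mul, derivRF_C_mul, hf, hg]; ring)
  have hv : ∀ {t u : ℂ}, HasValue t f u → HasValue t g u → d * u - e * u = k :=
    fun {t u} h h' => by
      have h1 := ((HasValue.const t d).mul h).sub ((HasValue.const t e).mul h')
      rw [hk] at h1
      rw [← h1.eval_eq, (HasValue.const t k).eval_eq]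
  have hk0 : k = 0 := by simpa using (hv hf₀ hg₀).symm
  have hde : d = e := by
    have := hv hf₁ hg₁
    rw [hk0] at this
    linear_combination this
  rw [hk0, hde, map_zero, sub_eq_zero] at hk
  exact mul_left_cancel₀ (by simpa using he) hk

end Configuration

/-! ### Pullback along Möbius transformations -/

section Moebius

variable {p q r s : ℂ}

/-- The Möbius transformation `z ↦ (p z + q) / (r z + s)` as a rational function. -/
noncomputable def moebius (p q r s : ℂ) : RatFunc ℂ :=
  (RatFunc.C p * RatFunc.X + RatFunc.C q) / (RatFunc.C r * RatFunc.X + RatFunc.C s)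

lemma linear_ne_zero (hD : p * s - q * r ≠ 0) : (C r * X + C s : ℂ[X]) ≠ 0 := by
  intro h
  have h0 := congrArg (fun P => coeff P 0) h
  have h1 := congrArg (fun P => coeff P 1) h
  simp at h0 h1
  simp [h0, h1] at hD

lemma moebius_eq_div (p q r s : ℂ) : moebius p q r s =
    algebraMap ℂ[X] (RatFunc ℂ) (C p * X + C q) / algebraMap ℂ[X] (RatFunc ℂ) (C r * X + C s) := by
  simp only [moebius, map_add, map_mul, RatFunc.algebraMap_C, RatFunc.algebraMap_X]

lemma ratFunc_linear_ne_zero (hD : p * s - q * r ≠ 0) :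
    (RatFunc.C r * RatFunc.X + RatFunc.C s : RatFunc ℂ) ≠ 0 := by
  simpa only [map_add, map_mul, RatFunc.algebraMap_C, RatFunc.algebraMap_X] using
    RatFunc.algebraMap_ne_zero (linear_ne_zero hD)

lemma derivRF_moebius (hD : p * s - q * r ≠ 0) : derivRF (moebius p q r s) =
    RatFunc.C (p * s - q * r) / (RatFunc.C r * RatFunc.X + RatFunc.C s) ^ 2 := by
  rw [moebius_eq_div, derivRF_div _ _ (linear_ne_zero hD)]
  congr 1
  · rw [← RatFunc.algebraMap_C]
    congr 1
    simp
    ring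
  · simp

lemma derivRF_moebius_ne_zero (hD : p * s - q * r ≠ 0) : derivRF (moebius p q r s) ≠ 0 := by
  rw [derivRF_moebius hD]
  exact div_ne_zero (RatFunc.C.injective.ne_iff' (map_zero _) |>.2 hD)
    (pow_ne_zero 2 (ratFunc_linear_ne_zero hD))

lemma derivRF_aeval (g : RatFunc ℂ) (P : ℂ[X]) :
    derivRF (aeval g P) = aeval g (derivative P) * derivRF g := by
  simpa only [derivRFDerivation_apply, smul_eq_mul] using derivRFDerivation.map_aeval P g

lemma transcendental_of_derivRF_ne_zero {g : RatFunc ℂ} (hg : derivRF g ≠ 0) :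
    Transcendental ℂ g := by
  by_contra h
  have hint := isAlgebraic_iff_isIntegral.1 (not_not.1 h)
  refine (minpoly.irreducible hint).separable.aeval_derivative_ne_zero (minpoly.aeval ℂ g) ?_
  have := derivRF_aeval g (minpoly ℂ g)
  rw [minpoly.aeval, ← map_zero RatFunc.C, derivRF_C, eq_comm] at this
  exact (mul_eq_zero.1 this).resolve_right hg

/-- Pullback of rational functions along a transcendental one. -/
noncomputable def pullback (g : RatFunc ℂ) (hg : Transcendental ℂ g) : RatFunc ℂ →ₐ[ℂ] RatFunc ℂ :=
  RatFunc.liftAlgHom (aeval g)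
    (nonZeroDivisors_le_comap_nonZeroDivisors_of_injective _ (transcendental_iff_injective.1 hg))

variable {g : RatFunc ℂ} (hg : Transcendental ℂ g)

lemma pullback_apply (f : RatFunc ℂ) :
    pullback g hg f = RatFunc.eval (algebraMap ℂ (RatFunc ℂ)) g f :=
  RatFunc.liftAlgHom_apply _ _ _ 

lemma pullback_div (P Q : ℂ[X]) : pullback g hg (algebraMap ℂ[X] (RatFunc ℂ) P /
    algebraMap ℂ[X] (RatFunc ℂ) Q) = aeval g P / aeval g Q :=
  RatFunc.liftAlgHom_apply_div _ _ _ _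

lemma pullback_C (k : ℂ) : pullback g hg (RatFunc.C k) = RatFunc.C k := by
  rw [← RatFunc.algebraMap_eq_C]; exact AlgHom.commutes _ _

lemma pullback_X : pullback g hg RatFunc.X = g := by
  simpa using pullback_div hg X 1

lemma derivRF_pullback (f : RatFunc ℂ) :
    derivRF (pullback g hg f) = pullback g hg (derivRF f) * derivRF g := by
  have hQ : aeval g f.denom ≠ 0 := fun h => f.denom_ne_zero
    (transcendental_iff_injective.1 hg (h.trans (map_zero _).symm))
  rw [← f.num_div_denom, derivRF_div _ _ f.denom_ne_zero, pullback_div, pullback_div]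
  have := derivRFDerivation.leibniz_div (aeval g f.num) (aeval g f.denom)
  simp only [derivRFDerivation_apply, derivRF_aeval] at this
  rw [this]
  simp
  field_simp

lemma HasValue.pullback {z v w : ℂ} {f : RatFunc ℂ} (hgz : HasValue z g v) (hf : HasValue v f w) :
    HasValue z (pullback g hg f) w := by
  obtain ⟨P, Q, hQ, rfl, rfl⟩ := hf
  rw [pullback_div, div_eq_mul_inv, div_eq_mul_inv]
  exact (hgz.aeval P).mul ((hgz.aeval Q).inv hQ)

lemma hasValue_moebius {z : ℂ} (hz : r * z + s ≠ 0) :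
    HasValue z (moebius p q r s) ((p * z + q) / (r * z + s)) :=
  ⟨C p * X + C q, C r * X + C s, by simpa using hz, moebius_eq_div p q r s, by simp⟩

lemma moebius_sub_C (hD : p * s - q * r ≠ 0) {z : ℂ} (hz : r * z + s ≠ 0) :
    moebius p q r s - RatFunc.C ((p * z + q) / (r * z + s)) =
      RatFunc.C ((p * s - q * r) / (r * z + s)) * (RatFunc.C r * RatFunc.X + RatFunc.C s)⁻¹ *
        (RatFunc.X - RatFunc.C z) := by
  have hL := ratFunc_linear_ne_zero hD
  have hz' : RatFunc.C r * RatFunc.C z + RatFunc.C s ≠ 0 := by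
    rw [← map_mul, ← map_add]
    exact RatFunc.C.injective.ne_iff' (map_zero _) |>.2 hz
  simp only [moebius, map_div₀, map_add, map_mul, map_sub]
  rw [div_sub_div _ _ hL hz', ← div_eq_mul_inv, div_div, div_mul_eq_mul_div,
    mul_comm (RatFunc.C r * RatFunc.C z + RatFunc.C s) (RatFunc.C r * RatFunc.X + RatFunc.C s)]
  congr 1
  ring

lemma pullback_omegaZ_mul {N : ℕ} {m : Fin N → ℤ} (hm : ∑ i, m i = -2) {Z W : Fin N → ℂ}
    (hD : p * s - q * r ≠ 0)
    (hW : ∀ i, r * Z i + s ≠ 0 ∧ W i = (p * Z i + q) / (r * Z i + s))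
    (hg : Transcendental ℂ (moebius p q r s)) :
    ∃ k : ℂ, pullback (moebius p q r s) hg (omegaZ m W) * derivRF (moebius p q r s) =
      RatFunc.C k * omegaZ m Z := by
  have hL := ratFunc_linear_ne_zero hD
  refine ⟨(∏ i, ((p * s - q * r) / (r * Z i + s)) ^ m i) * (p * s - q * r), ?_⟩
  have hprod : pullback (moebius p q r s) hg (omegaZ m W) =
      RatFunc.C (∏ i, ((p * s - q * r) / (r * Z i + s)) ^ m i) *
        (RatFunc.C r * RatFunc.X + RatFunc.C s) ^ 2 * omegaZ m Z := by
    unfold omegaZ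
    have hpow : (RatFunc.C r * RatFunc.X + RatFunc.C s : RatFunc ℂ) ^ 2 =
        ∏ i, ((RatFunc.C r * RatFunc.X + RatFunc.C s)⁻¹) ^ m i := by
      have h2 : ∀ (x : RatFunc ℂ) (hx : x ≠ 0) (T : Finset (Fin N)),
          ∏ i ∈ T, x ^ m i = x ^ ∑ i ∈ T, m i := fun x hx T => by
        classical
        induction T using Finset.induction_on with
        | empty => simp
        | insert i T hi ih => rw [Finset.prod_insert hi, Finset.sum_insert hi, ih, zpow_add₀ hx]
      rw [h2 _ (inv_ne_zero hL), hm, inv_zpow', neg_neg]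
      norm_cast
    rw [hpow, map_prod, map_prod, ← Finset.prod_mul_distrib, ← Finset.prod_mul_distrib]
    refine Finset.prod_congr rfl fun i _ => ?_
    rw [map_zpow₀, map_zpow₀, map_sub, pullback_X, pullback_C, (hW i).2, moebius_sub_C hD (hW i).1,
      mul_zpow, mul_zpow]
  rw [hprod, derivRF_moebius hD, map_mul]
  field_simp

end Moebius

/-! ### Coverings and configurations -/

section Correspondence

variable {a b n : ℕ} {c : Fin n → ℕ}

lemma sum_multFirst (hsum : (a : ℤ) + b - ∑ i, (c i : ℤ) = -2) :
    ∑ i, multFirst a b c i = -2 := by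
  unfold multFirst
  rw [Fin.sum_univ_add, Fin.sum_univ_two]
  simp only [Fin.append_left, Fin.append_right, Matrix.cons_val_zero, Matrix.cons_val_one,
    Finset.sum_neg_distrib]
  linarith

/-- The configuration of critical points of a covering. -/
noncomputable def configuration (F : Cover a b c) : H₀first a b c :=
  ⟨F.val.2, F.property.1, fun j => by
    obtain ⟨e, he⟩ := F.property.2.1
    have h := residueAt_derivRF (F.val.2 (Fin.natAdd 2 j)) F.val.1
    rw [he, residueAt_C_mul] at h
    exact (mul_eq_zero.1 h).resolve_left e.ne_zero⟩

lemma hasValue_zero (F : Cover a b c) :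
    HasValue (F.val.2 (Fin.castAdd n 0)) F.val.1 0 := by
  obtain ⟨e, he⟩ := F.property.2.1
  have h := hasValue_eval (denom_eval_castAdd_ne_zero F.property.1 he 0)
  have h0 : RatFunc.eval (RingHom.id ℂ) (F.val.2 (Fin.castAdd n 0)) F.val.1 = 0 :=
    F.property.2.2.1
  rwa [h0] at h

lemma hasValue_one (F : Cover a b c) :
    HasValue (F.val.2 (Fin.castAdd n 1)) F.val.1 1 := by
  obtain ⟨e, he⟩ := F.property.2.1
  have h := hasValue_eval (denom_eval_castAdd_ne_zero F.property.1 he 1)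
  have h1 : RatFunc.eval (RingHom.id ℂ) (F.val.2 (Fin.castAdd n 1)) F.val.1 = 1 :=
    F.property.2.2.2
  rwa [h1] at h

lemma exists_cover (hn : 1 ≤ n) (hc : ∀ i, 2 ≤ c i)
    (hsum : (a : ℤ) + b - ∑ i, (c i : ℤ) = -2) (Z : H₀first a b c) :
    ∃ F : Cover a b c, configuration F = Z := by
  have hsum' : a + b + 2 = ∑ i, c i := by
    have : (a : ℤ) + b + 2 = ((∑ i, c i : ℕ) : ℤ) := by push_cast; linarith
    exact_mod_cast this
  obtain ⟨f, he, h₀, h₁⟩ := exists_normalized_primitive hn hc hsum' Z.property.1 Z.property.2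
  exact ⟨⟨(f, Z.val), Z.property.1, he, h₀.eval_eq, h₁.eval_eq⟩, Subtype.ext rfl⟩

lemma coverRel_of_moebiusRelFirst (hsum : (a : ℤ) + b - ∑ i, (c i : ℤ) = -2) {F G : Cover a b c}
    (h : moebiusRelFirst a b c (configuration G) (configuration F)) : coverRel a b c F G := by
  obtain ⟨p, q, r, s, hD, hW⟩ := h
  change ∀ i, r * G.val.2 i + s ≠ 0 ∧
    F.val.2 i = (p * G.val.2 i + q) / (r * G.val.2 i + s) at hW
  refine ⟨p, q, r, s, hD, hW, ?_⟩
  have hg := transcendental_of_derivRF_ne_zero (derivRF_moebius_ne_zero hD)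
  change G.val.1 = RatFunc.eval (algebraMap ℂ (RatFunc ℂ)) (moebius p q r s) F.val.1
  rw [← pullback_apply hg]
  obtain ⟨e, he⟩ := F.property.2.1
  obtain ⟨d, hd⟩ := G.property.2.1
  obtain ⟨k, hk⟩ := pullback_omegaZ_mul (sum_multFirst hsum) hD hW hg
  have hF : derivRF (pullback (moebius p q r s) hg F.val.1) =
      RatFunc.C (e * k) * omegaZ (multFirst a b c) G.val.2 := by
    rw [derivRF_pullback, he, map_mul, pullback_C, mul_assoc, hk, map_mul, mul_assoc]
  have hval : ∀ i, HasValue (G.val.2 i) (moebius p q r s) (F.val.2 i) := fun i => by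
    rw [(hW i).2]
    exact hasValue_moebius (hW i).1
  exact normalized_primitive_unique d.ne_zero hd hF (hasValue_zero G)
    ((hval _).pullback hg (hasValue_zero F)) (hasValue_one G)
    ((hval _).pullback hg (hasValue_one F))

lemma moebiusRelFirst_of_coverRel {F G : Cover a b c} (h : coverRel a b c F G) :
    moebiusRelFirst a b c (configuration G) (configuration F) := by
  obtain ⟨p, q, r, s, hD, hW, -⟩ := h
  exact ⟨p, q, r, s, hD, hW⟩

lemma moebiusRelFirst_refl (Z : H₀first a b c) : moebiusRelFirst a b c Z Z :=
  ⟨1, 0, 0, 1, by simp, fun i => by simp⟩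

/-- Taking critical points induces a bijection between isomorphism classes of coverings and
equivalence classes of configurations. -/
noncomputable def coverEquiv (hn : 1 ≤ n) (hc : ∀ i, 2 ≤ c i)
    (hsum : (a : ℤ) + b - ∑ i, (c i : ℤ) = -2) :
    Quot (coverRel a b c) ≃ Quot (moebiusRelFirst a b c) where
  toFun := Quot.lift (fun F => Quot.mk _ (configuration F)) fun _ _ h =>
    (Quot.sound (moebiusRelFirst_of_coverRel h)).symm
  invFun := Quot.lift (fun Z => Quot.mk _ (exists_cover hn hc hsum Z).choose) fun Z W h =>
    (Quot.sound (coverRel_of_moebiusRelFirst hsum (by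
      rwa [(exists_cover hn hc hsum Z).choose_spec,
        (exists_cover hn hc hsum W).choose_spec]))).symm
  left_inv := by
    rintro ⟨F⟩
    refine Quot.sound (coverRel_of_moebiusRelFirst hsum ?_)
    rw [(exists_cover hn hc hsum (configuration F)).choose_spec]
    exact moebiusRelFirst_refl _
  right_inv := by
    rintro ⟨Z⟩
    exact congrArg (Quot.mk _) (exists_cover hn hc hsum Z).choose_spec

end Correspondence

end RatFuncDeriv

/-- for `a, b ≥ 0`, `cᵢ ≥ 2` with `a + b - ∑ cᵢ = -2`, the map `f ↦ df`
induces a bijection between degree-`(∑ cᵢ - n)` ramified coverings of `ℂP¹` with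
ramification profile `(a+1)` over `0`, `(b+1)` over `1`, `(c₁-1,…,cₙ-1)` over `∞`
(plus simple points), up to isomorphism, and `𝓗₀(a, b; -c₁, …, -cₙ)`, the set of
configurations supporting a differential with zeros of orders `a, b` and residueless
poles of orders `c₁, …, cₙ`, up to `PGL(2,ℂ)`. -/
theorem statement15 (a b : ℕ) (n : ℕ) (hn : 1 ≤ n) (c : Fin n → ℕ) (hc : ∀ i, 2 ≤ c i)
    (hsum : (a : ℤ) + b - ∑ i, (c i : ℤ) = -2) :
    ∃ Φ : Quot (coverRel a b c) ≃ Quot (moebiusRelFirst a b c),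
      ∀ (F : Cover a b c)
        (h : Function.Injective F.val.2 ∧
          ∀ j : Fin n, residueAt (F.val.2 (Fin.natAdd 2 j))
            (omegaZ (multFirst a b c) F.val.2) = 0),
        Φ (Quot.mk _ F) = Quot.mk _ (⟨F.val.2, h⟩ : H₀first a b c) := by
  exact ⟨RatFuncDeriv.coverEquiv hn hc hsum, fun _ _ => rfl⟩
end

section
/- With $B(y)=1-\sum_{i\ge1}(i-1)y^it_i$, $\widetilde A(x,y)=(x^{-1}-y^{-1})\left(1+\sum_{i\ge0}\frac{x^i-y^i}{x^{-1}-y^{-1}}t_{i+1}\right)$, and $\mu_c=x^{c-1}-y^{c-1}$, for any integers $c\ge2$ and $f\ge1$ the following identity of formal Laurent series holds: $\frac{\mu_c}{\widetilde A(x,y)^2}\frac{x^fy^{-1}}{B(x)}+y\partial_y\!\left(\frac{\mu_c}{\widetilde A(x,y)}\right)\frac{x^f}{B(x)B(y)}-\frac{(c-1)x^fy^c}{B(x)B(y)^2}+\frac{x^{f-1}(c-1)y^c}{\widetilde A(x,y)B(y)^2}+\frac{x^f(c-1)y^c}{B(x)B(y)^2}\,(x\partial_x+y\partial_y)\log A(x,y)=0$,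 where $A(x,y)=\frac{\widetilde A(x,y)}{x^{-1}-y^{-1}}$. -/
open Finset

noncomputable section

/-- The coefficient ring `ℚ[t₁, t₂, …]` (with `tᵢ = X i`; only `tᵢ` with `i ≥ 2` occur). -/
abbrev Rt : Type := MvPolynomial ℕ ℚ

/-- Formal Laurent series in the variable `y` over `Rt`. -/
abbrev L1 : Type := LaurentSeries Rt

/-- Formal Laurent series in `x` whose coefficients are formal Laurent series in `y`:
the ring where all our computations take place. -/
abbrev L2 : Type := LaurentSeries L1

def xx : L2 := HahnSeries.single 1 1
def yy : L2 := HahnSeries.single 0 (HahnSeries.single 1 1)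
def xinv : L2 := HahnSeries.single (-1) 1
def yinv : L2 := HahnSeries.single 0 (HahnSeries.single (-1) 1)

/-- The variable `tᵢ`, as a constant of `L2`. -/
def tE (i : ℕ) : L2 := HahnSeries.C (HahnSeries.C (MvPolynomial.X i))

/-- `A(x,y) = 1 + ∑_{i ≥ 0} ((xⁱ - yⁱ)/(x⁻¹ - y⁻¹)) t_{i+1}`.  Since
`(xⁱ - yⁱ)/(x⁻¹ - y⁻¹) = -∑_{k=0}^{i-1} x^(k+1) y^(i-k)`, regrouping the (coefficientwise
finite) sum by the exponents `(a,b) = (k+1, i-k)` gives `A = 1 - ∑_{a,b ≥ 1} x^a y^b t_{a+b}`. -/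
def SA : L2 :=
  HahnSeries.ofPowerSeries ℤ L1 (PowerSeries.mk fun a =>
    if a = 0 then 0 else
      HahnSeries.ofPowerSeries ℤ Rt (PowerSeries.mk fun b =>
        if b = 0 then 0 else MvPolynomial.X (a + b)))

def Aser : L2 := 1 - SA

/-- `B(y) = 1 - ∑_{i ≥ 1} (i-1) yⁱ tᵢ`, as a Laurent series in `y`. -/
def B1 : L1 :=
  1 - HahnSeries.ofPowerSeries ℤ Rt (PowerSeries.mk fun i =>
    if i = 0 then 0 else ((i : ℚ) - 1) • MvPolynomial.X i)

/-- `B(x)`, as an element of `L2`. -/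
def BofX : L2 :=
  1 - HahnSeries.ofPowerSeries ℤ L1 (PowerSeries.mk fun i =>
    if i = 0 then 0 else HahnSeries.C (((i : ℚ) - 1) • MvPolynomial.X i))

/-- `B(y)`, as an element of `L2`. -/
def BofY : L2 := HahnSeries.C B1

/-- `Ã(x,y) = (x⁻¹ - y⁻¹) A(x,y)`. -/
def Atilde : L2 := (xinv - yinv) * Aser

/-- `y ∂_y` on Laurent series in `y`. -/
def idy (G : L1) : L1 where
  coeff m := m • G.coeff m
  isPWO_support' := G.isPWO_support'.mono (by
    intro m hm
    simp only [Function.mem_support] at hm ⊢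
    intro h; apply hm; rw [h, smul_zero])

/-- `y ∂_y` on `L2`. -/
def ydy (F : L2) : L2 where
  coeff n := idy (F.coeff n)
  isPWO_support' := F.isPWO_support'.mono (by
    intro n hn
    simp only [Function.mem_support] at hn ⊢
    intro h; apply hn; rw [h]
    ext m; simp [idy])

/-- `x ∂_x` on `L2`. -/
def xdx (F : L2) : L2 where
  coeff n := n • F.coeff n
  isPWO_support' := F.isPWO_support'.mono (by
    intro n hn
    simp only [Function.mem_support] at hn ⊢
    intro h; apply hn; rw [h]; simp)

/-- `log A(x,y) = log (1 - SA) = -∑_{n ≥ 1} SAⁿ/n` (the sum is finite in each power of `x`,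
since `SA` only involves positive powers of `x`). -/
def logA : L2 :=
  HahnSeries.ofPowerSeries ℤ L1 (PowerSeries.mk fun n =>
    -∑ m ∈ Finset.Icc 1 n, (m : ℚ)⁻¹ • ((SA ^ m).coeff (n : ℤ)))

/-- `∑_{i ≥ 0} i ((xⁱ - yⁱ)/(x⁻¹ - y⁻¹)) t_{i+1} = -∑_{a,b ≥ 1} (a+b-1) x^a y^b t_{a+b}`. -/
def DS : L2 :=
  - HahnSeries.ofPowerSeries ℤ L1 (PowerSeries.mk fun a =>
    if a = 0 then 0 else
      HahnSeries.ofPowerSeries ℤ Rt (PowerSeries.mk fun b =>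
        if b = 0 then 0 else ((a : ℚ) + (b : ℚ) - 1) • MvPolynomial.X (a + b)))

end

namespace EulerIdentity

/-- A coefficientwise operator on Laurent series whose components satisfy a graded Leibniz rule
satisfies the Leibniz rule. -/
theorem leibniz_of_coeff {R : Type*} [CommRing R] (d : ℤ → R →+ R)
    (hd : ∀ i j a b, d (i + j) (a * b) = a * d j b + d i a * b)
    (D : LaurentSeries R → LaurentSeries R) (hD : ∀ F n, (D F).coeff n = d n (F.coeff n))
    (F G : LaurentSeries R) : D (F * G) = F * D G + G * D F := by
  have hs : ∀ F, (D F).support ⊆ F.support := by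
    intro F n hn h
    exact hn (by rw [hD, h, map_zero])
  ext n
  rw [hD, mul_comm G, HahnSeries.coeff_add, HahnSeries.coeff_mul, map_sum,
    HahnSeries.coeff_mul_right' G.isPWO_support (hs G),
    HahnSeries.coeff_mul_left' F.isPWO_support (hs F), ← Finset.sum_add_distrib]
  refine Finset.sum_congr rfl fun ij hij => ?_
  obtain ⟨-, -, h⟩ := Finset.mem_antidiagonal.mp hij
  rw [← h, hd, hD, hD]

theorem idy_mul (F G : L1) : idy (F * G) = F * idy G + G * idy F :=
  leibniz_of_coeff (fun n => zsmulAddGroupHom n)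
    (fun i j a b => by simp only [zsmulAddGroupHom_apply, zsmul_eq_mul]; push_cast; ring) idy
    (fun _ _ => rfl) F G

/-- `y ∂_y` on Laurent series in `y`, as an additive map. -/
noncomputable def idyHom : L1 →+ L1 :=
  AddMonoidHom.mk' idy fun F G => by
    ext1
    funext n
    exact smul_add n (F.coeff n) (G.coeff n)

theorem xdx_mul (F G : L2) : xdx (F * G) = F * xdx G + G * xdx F :=
  leibniz_of_coeff (fun n => zsmulAddGroupHom n)
    (fun i j a b => by simp only [zsmulAddGroupHom_apply, zsmul_eq_mul]; push_cast; ring) xdx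
    (fun _ _ => rfl) F G

theorem ydy_mul (F G : L2) : ydy (F * G) = F * ydy G + G * ydy F :=
  leibniz_of_coeff (fun _ => idyHom)
    (fun i j a b => (idy_mul a b).trans (by rw [mul_comm b]; rfl)) ydy (fun _ _ => rfl) F G

/-- `x ∂_x` on `L2`, as an additive map. -/
noncomputable def xdxHom : L2 →+ L2 :=
  AddMonoidHom.mk' xdx fun F G => by
    ext1
    funext n
    exact smul_add n (F.coeff n) (G.coeff n)

/-- `y ∂_y` on `L2`, as an additive map. -/
noncomputable def ydyHom : L2 →+ L2 :=
  AddMonoidHom.mk' ydy fun F G => by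
    ext1
    funext n
    exact map_add idyHom (F.coeff n) (G.coeff n)

/-- The Euler operator `x ∂_x + y ∂_y` on `L2`. -/
noncomputable def euler : L2 →+ L2 := xdxHom + ydyHom

theorem euler_apply (F : L2) : euler F = xdx F + ydy F := rfl

theorem euler_sub (F G : L2) : euler (F - G) = euler F - euler G := map_sub euler F G

theorem euler_mul (F G : L2) : euler (F * G) = F * euler G + G * euler F := by
  simp only [euler_apply, xdx_mul, ydy_mul]
  ring

theorem leibniz_one {R : Type*} [CommRing R] {d : R →+ R}
    (hd : ∀ a b, d (a * b) = a * d b + b * d a) : d 1 = 0 := by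
  have h := hd 1 1
  rw [mul_one, one_mul] at h
  exact left_eq_add.mp h

theorem leibniz_pow {R : Type*} [CommRing R] {d : R →+ R}
    (hd : ∀ a b, d (a * b) = a * d b + b * d a) (a : R) (n : ℕ) :
    d (a ^ (n + 1)) = (n + 1 : ℕ) * (a ^ n * d a) := by
  induction n with
  | zero => simp
  | succ n ih =>
    rw [pow_succ, hd, ih]
    push_cast
    ring

theorem leibniz_pow_of_eigen {R : Type*} [CommRing R] {d : R →+ R}
    (hd : ∀ a b, d (a * b) = a * d b + b * d a) {a k : R} (h : d a = k * a) (n : ℕ) :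
    d (a ^ n) = k * (n * a ^ n) := by
  induction n with
  | zero => simp [leibniz_one hd]
  | succ n ih =>
    rw [pow_succ, hd, ih, h]
    push_cast
    ring

theorem leibniz_inverse {R : Type*} [CommRing R] {d : R →+ R}
    (hd : ∀ a b, d (a * b) = a * d b + b * d a) {a b : R}
    (h : a * b = 1) : d b = -(b ^ 2 * d a) := by
  have h1 : a * d b + b * d a = 0 := by rw [← hd, h, leibniz_one hd]
  linear_combination b * h1 - d b * h

theorem euler_rat_smul (q : ℚ) (F : L2) : euler (q • F) = q • euler F := map_rat_smul euler q F

theorem euler_one : euler 1 = 0 := leibniz_one (R := L2) euler_mul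

theorem euler_pow (F : L2) (n : ℕ) :
    euler (F ^ (n + 1)) = ((n + 1 : ℕ) : L2) * (F ^ n * euler F) :=
  leibniz_pow (R := L2) euler_mul F n

/-- `F` is divisible by `x ^ N`. -/
def VanishBelow (N : ℤ) (F : L2) : Prop := ∀ n < N, F.coeff n = 0

theorem VanishBelow.mono {M N : ℤ} {F : L2} (h : VanishBelow N F) (hM : M ≤ N) :
    VanishBelow M F := fun n hn => h n (hn.trans_le hM)

theorem VanishBelow.add {N : ℤ} {F G : L2} (hF : VanishBelow N F) (hG : VanishBelow N G) :
    VanishBelow N (F + G) := fun n hn => by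
  rw [HahnSeries.coeff_add, hF n hn, hG n hn, add_zero]

theorem VanishBelow.sub {N : ℤ} {F G : L2} (hF : VanishBelow N F) (hG : VanishBelow N G) :
    VanishBelow N (F - G) := fun n hn => by
  rw [HahnSeries.coeff_sub, hF n hn, hG n hn, sub_zero]

theorem VanishBelow.mul {M N : ℤ} {F G : L2} (hF : VanishBelow M F) (hG : VanishBelow N G) :
    VanishBelow (M + N) (F * G) := fun n hn => by
  rw [HahnSeries.coeff_mul]
  refine Finset.sum_eq_zero fun ij hij => ?_
  obtain ⟨-, -, h⟩ := Finset.mem_antidiagonal.mp hij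
  rcases lt_or_ge ij.1 M with h1 | h1
  · rw [hF _ h1, zero_mul]
  · rw [hG _ (by omega), mul_zero]

theorem VanishBelow.euler {N : ℤ} {F : L2} (hF : VanishBelow N F) :
    VanishBelow N (euler F) := fun n hn => by
  change n • F.coeff n + idyHom (F.coeff n) = 0
  rw [hF n hn, smul_zero, map_zero, add_zero]

theorem vanishBelow_one : VanishBelow 0 1 := fun n hn => by
  rw [HahnSeries.coeff_one, if_neg hn.ne]

theorem VanishBelow.pow {F : L2} (hF : VanishBelow 1 F) (m : ℕ) : VanishBelow m (F ^ m) := by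
  induction m with
  | zero => simpa using vanishBelow_one
  | succ m ih =>
    rw [pow_succ]
    push_cast
    exact ih.mul hF

theorem eq_zero_of_vanishBelow {F : L2} (h : ∀ N : ℕ, VanishBelow N F) : F = 0 := by
  ext1
  funext n
  exact h (n.toNat + 1) n (by push_cast; omega)

theorem coeff_SA (a b : ℤ) :
    (SA.coeff a).coeff b = if 0 < a ∧ 0 < b then MvPolynomial.X (a + b).toNat else 0 := by
  rw [SA, PowerSeries.coeff_coe]
  rcases lt_trichotomy a 0 with ha | rfl | ha
  · rw [if_pos ha, if_neg (by omega), HahnSeries.coeff_zero]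
  · simp
  rw [if_neg ha.not_gt, PowerSeries.coeff_mk, if_neg (by omega), PowerSeries.coeff_coe]
  rcases lt_trichotomy b 0 with hb | rfl | hb
  · rw [if_pos hb, if_neg (by omega)]
  · simp
  rw [if_neg hb.not_gt, PowerSeries.coeff_mk, if_neg (by omega), if_pos ⟨ha, hb⟩]
  congr 1
  omega

theorem vanishBelow_SA : VanishBelow 1 SA := fun n hn => by
  ext m
  rw [coeff_SA, if_neg (by omega), HahnSeries.coeff_zero]

/-- The partial sums of the series of `log (1 - SA)`. -/
noncomputable def logPartial (N : ℕ) : L2 := -∑ m ∈ Finset.Icc 1 N, (m : ℚ)⁻¹ • SA ^ m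

theorem logPartial_succ (N : ℕ) :
    logPartial (N + 1) = logPartial N - ((N + 1 : ℕ) : ℚ)⁻¹ • SA ^ (N + 1) := by
  rw [logPartial, logPartial, Finset.sum_Icc_succ_top (by omega)]
  exact neg_add' (α := L2) _ _

theorem VanishBelow.rat_smul {N : ℤ} {F : L2} (hF : VanishBelow N F) (q : ℚ) :
    VanishBelow N (q • F) := fun n hn => by
  rw [HahnSeries.coeff_smul, hF n hn, smul_zero]

theorem coeff_logPartial_of_le {k N : ℕ} (h : k ≤ N) :
    (logPartial N).coeff k = (logPartial k).coeff k := by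
  induction N, h using Nat.le_induction with
  | base => rfl
  | succ N hN ih =>
    rw [logPartial_succ, HahnSeries.coeff_sub, ih,
      (vanishBelow_SA.pow (N + 1)).rat_smul _ k (by omega), sub_zero]

theorem coeff_logPartial_self (N : ℕ) (k : ℤ) : (logPartial N).coeff k =
    -∑ m ∈ Finset.Icc 1 N, (m : ℚ)⁻¹ • (SA ^ m).coeff k := by
  have hsum := map_sum (HahnSeries.coeff.addMonoidHom k) (fun m : ℕ => (m : ℚ)⁻¹ • SA ^ m)
    (Finset.Icc 1 N)
  exact congrArg Neg.neg hsum

theorem vanishBelow_logPartial (N : ℕ) : VanishBelow 1 (logPartial N) := by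
  induction N with
  | zero => exact fun n _ => by simp [logPartial]
  | succ N ih =>
    rw [logPartial_succ]
    exact ih.sub (((vanishBelow_SA.pow (N + 1)).mono (by push_cast; omega)).rat_smul _)

theorem vanishBelow_logA_sub (N : ℕ) : VanishBelow N (logA - logPartial N) := fun n hn => by
  rw [HahnSeries.coeff_sub, logA, PowerSeries.coeff_coe]
  split_ifs with h
  · rw [vanishBelow_logPartial N n (by omega), sub_zero]
  · lift n to ℕ using not_lt.mp h
    rw [Int.natAbs_natCast, PowerSeries.coeff_mk, ← coeff_logPartial_self,
      coeff_logPartial_of_le (show n ≤ N by omega)]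
    exact sub_self (G := L1) _

theorem one_sub_mul_geom_step {R : Type*} [CommRing R] {a e l : R} {N : ℕ}
    (h : (1 - a) * l = (a ^ N - 1) * e) :
    (1 - a) * (l - a ^ N * e) = (a ^ (N + 1) - 1) * e := by
  linear_combination h

theorem sub_one_mul_eq_zero {R : Type*} [CommRing R] (e : R) : (1 - 1) * e = 0 := by
  ring

theorem one_sub_mul_euler_logPartial (N : ℕ) :
    (1 - SA) * euler (logPartial N) = (SA ^ N - 1) * euler SA := by
  induction N with
  | zero =>
    have h : logPartial 0 = 0 := by
      rw [logPartial, Finset.Icc_eq_empty (by omega), Finset.sum_empty]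
      exact neg_zero (G := L2)
    rw [h, map_zero, mul_zero, pow_zero]
    exact (sub_one_mul_eq_zero (R := L2) _).symm
  | succ N ih =>
    have h : ((N + 1 : ℕ) : ℚ)⁻¹ • (((N + 1 : ℕ) : L2) * (SA ^ N * euler SA)) =
        SA ^ N * euler SA := by
      rw [← nsmul_eq_mul, ← Nat.cast_smul_eq_nsmul ℚ, inv_smul_smul₀]
      exact Nat.cast_ne_zero.mpr N.succ_ne_zero
    rw [logPartial_succ, euler_sub, euler_rat_smul, euler_pow, h]
    exact one_sub_mul_geom_step (R := L2) ih

theorem mul_sub_eq_of_partial {R : Type*} [CommRing R] {a e l p s : R}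
    (h : (1 - s) * p = (a - 1) * e) :
    (1 - s) * l - (0 - e) = (1 - s) * (l - p) + a * e := by
  linear_combination h

theorem Aser_mul_euler_logA : Aser * euler logA = euler Aser := by
  refine sub_eq_zero.mp (eq_zero_of_vanishBelow fun N => ?_)
  have hA : VanishBelow 0 Aser := vanishBelow_one.sub (vanishBelow_SA.mono zero_le_one)
  have h1 := hA.mul (vanishBelow_logA_sub N).euler
  have h2 := (vanishBelow_SA.pow N).mul (vanishBelow_SA.mono zero_le_one).euler
  have h3 := h1.add (h2.mono (by omega))
  rw [zero_add, euler_sub] at h3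
  have h4 : euler Aser = 0 - euler SA := by
    rw [Aser, euler_sub, euler_one]
  rw [h4]
  exact (mul_sub_eq_of_partial (R := L2) (one_sub_mul_euler_logPartial N)).symm ▸ h3

/-- The series `y⁻¹ + ∑_{i ≥ 1} yⁱ t_{i+1}`. -/
noncomputable def Q1 : L1 := HahnSeries.single (-1) 1 +
  HahnSeries.ofPowerSeries ℤ Rt (PowerSeries.mk fun i =>
    if i = 0 then 0 else MvPolynomial.X (i + 1))

theorem coeff_Q1 (n : ℤ) : Q1.coeff n =
    if n = -1 then 1 else if 0 < n then MvPolynomial.X (n + 1).toNat else 0 := by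
  rw [Q1, HahnSeries.coeff_add, PowerSeries.coeff_coe, HahnSeries.coeff_single,
    PowerSeries.coeff_mk]
  rcases lt_trichotomy n 0 with h | rfl | h
  · simp [h, h.not_gt]
  · simp
  · rw [if_neg (by omega), if_neg (by omega), if_neg (by omega), if_neg (by omega), if_pos h,
      zero_add]
    congr 1
    omega

theorem coeff_B1 (n : ℤ) : B1.coeff n =
    if n = 0 then 1 else if 0 < n then (1 - n) • MvPolynomial.X n.toNat else 0 := by
  rw [B1, HahnSeries.coeff_sub, PowerSeries.coeff_coe, HahnSeries.coeff_one,
    PowerSeries.coeff_mk]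
  rcases lt_trichotomy n 0 with h | rfl | h
  · simp [h, h.ne, h.not_gt]
  · simp
  · lift n to ℕ using h.le
    rw [if_neg (by omega), if_neg (by omega), if_neg (by omega), if_neg (by omega), if_pos h,
      zero_sub, ← neg_smul, ← Int.cast_smul_eq_zsmul ℚ]
    simp

theorem coeff_xinv_mul (F : L2) (n : ℤ) : (xinv * F).coeff n = F.coeff (n + 1) := by
  simp [xinv, HahnSeries.coeff_single_mul]

theorem coeff_yinv_mul (F : L2) (n : ℤ) :
    (yinv * F).coeff n = HahnSeries.single (-1) 1 * F.coeff n := by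
  simp [yinv]

theorem coeff_yinv_mul_coeff (F : L2) (n m : ℤ) :
    ((yinv * F).coeff n).coeff m = (F.coeff n).coeff (m + 1) := by
  rw [coeff_yinv_mul]
  simp [HahnSeries.coeff_single_mul]

theorem Atilde_eq : Atilde = Q1.map (HahnSeries.C : Rt →+* L1) - HahnSeries.C Q1 := by
  ext1
  funext n
  ext1
  funext m
  have h : Atilde = xinv * Aser - yinv * Aser := sub_mul (α := L2) _ _ _
  rw [h, HahnSeries.coeff_sub, HahnSeries.coeff_sub, coeff_xinv_mul,
    coeff_yinv_mul_coeff, HahnSeries.coeff_sub, HahnSeries.coeff_sub, HahnSeries.map_coeff,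
    HahnSeries.C_apply, HahnSeries.C_apply, HahnSeries.coeff_single, HahnSeries.coeff_single]
  simp only [Aser, HahnSeries.coeff_sub, HahnSeries.coeff_one, coeff_SA]
  have h1 : ∀ (p : Prop) [Decidable p] (k : ℤ),
      (if p then (1 : L1) else 0).coeff k = if p ∧ k = 0 then 1 else 0 := by
    intro p _ k
    by_cases hp : p <;> simp [hp, HahnSeries.coeff_one]
  have h2 : ∀ (p : Prop) [Decidable p] (F : L1) (k : ℤ),
      (if p then F else 0).coeff k = if p then F.coeff k else 0 := by
    intro p _ F k
    split_ifs <;> rfl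
  rw [h1, h1, h2, coeff_Q1, coeff_Q1, show n + 1 + m = n + (m + 1) by ring]
  rcases lt_trichotomy n 0 with hn | rfl | hn
  · rw [if_neg (show ¬(0 < n + 1 ∧ 0 < m) by omega), if_neg (show ¬(n = 0 ∧ m + 1 = 0) by omega),
      if_neg (show ¬(0 < n ∧ 0 < m + 1) by omega), if_neg hn.not_gt, if_neg hn.ne]
    by_cases hm : m = 0 <;> simp [hm, eq_neg_iff_add_eq_zero]
  · by_cases hm : m = -1
    · simp [hm]
    · by_cases hm' : 0 < m <;> simp [hm, hm', ← eq_neg_iff_add_eq_zero]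
  · rcases lt_trichotomy m 0 with hm | rfl | hm
    · have h3 : ¬0 < m + 1 := by omega
      simp [hn.ne', hm.ne, hm.not_gt, h3]
    · have h3 : ¬n + 1 = 0 := by omega
      have h4 : ¬n = -1 := by omega
      simp [hn, hn.ne', h3, h4]
    · have h3 : 0 < n + 1 := by omega
      have h4 : 0 < m + 1 := by omega
      simp [hn, hn.ne', hm, hm.ne', h3, h4]

theorem idy_Q1 : idy Q1 = -(HahnSeries.single (-1) 1 * B1) := by
  ext1
  funext n
  rw [HahnSeries.coeff_neg, HahnSeries.coeff_single_mul, coeff_B1]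
  change n • Q1.coeff n = _
  rw [coeff_Q1]
  rw [sub_neg_eq_add, one_mul, if_congr (eq_neg_iff_add_eq_zero (a := n) (b := 1)) rfl rfl]
  split_ifs with h1 h2 h3 h3
  · rw [eq_neg_of_add_eq_zero_left h1, neg_one_zsmul]
  · rw [sub_add_cancel_right, neg_smul, neg_neg]
  · omega
  · rw [show n = 0 by omega]
    simp
  · simp

theorem BofX_eq : BofX = B1.map (HahnSeries.C : Rt →+* L1) := by
  ext1
  funext n
  rw [BofX, B1, HahnSeries.map_coeff, HahnSeries.coeff_sub, HahnSeries.coeff_sub,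
    HahnSeries.coeff_one, HahnSeries.coeff_one, PowerSeries.coeff_coe, PowerSeries.coeff_coe]
  simp only [PowerSeries.coeff_mk, map_sub, apply_ite HahnSeries.C, map_one, map_zero]
  congr

theorem ydy_sub (F G : L2) : ydy (F - G) = ydy F - ydy G := map_sub ydyHom F G

theorem xdx_sub (F G : L2) : xdx (F - G) = xdx F - xdx G := map_sub xdxHom F G

theorem ydy_C (F : L1) : ydy (HahnSeries.C F) = HahnSeries.C (idy F) := by
  ext1
  funext n
  change idy ((HahnSeries.C F).coeff n) = (HahnSeries.C (idy F)).coeff n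
  rw [HahnSeries.C_apply, HahnSeries.C_apply, HahnSeries.coeff_single, HahnSeries.coeff_single]
  split_ifs
  · rfl
  · exact map_zero idyHom

theorem xdx_C (F : L1) : xdx (HahnSeries.C F) = 0 := by
  ext1
  funext n
  change n • (HahnSeries.C F).coeff n = 0
  rw [HahnSeries.C_apply, HahnSeries.coeff_single]
  split_ifs with h
  · rw [h, zero_smul]
  · rw [smul_zero]

theorem ydy_map_C (F : L1) : ydy (F.map (HahnSeries.C : Rt →+* L1)) = 0 := by
  ext1
  funext n
  change idy ((F.map (HahnSeries.C : Rt →+* L1)).coeff n) = 0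
  rw [HahnSeries.map_coeff]
  ext1
  funext m
  change m • (HahnSeries.C (F.coeff n) : L1).coeff m = 0
  rw [HahnSeries.C_apply, HahnSeries.coeff_single]
  split_ifs with h
  · rw [h, zero_smul]
  · rw [smul_zero]

theorem xdx_map_C (F : L1) :
    xdx (F.map (HahnSeries.C : Rt →+* L1)) = (idy F).map (HahnSeries.C : Rt →+* L1) := by
  ext1
  funext n
  rw [HahnSeries.map_coeff]
  exact (map_zsmul (HahnSeries.C : Rt →+* L1) n (F.coeff n)).symm

theorem ydy_Atilde : ydy Atilde = yinv * BofY := by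
  rw [Atilde_eq, ydy_sub, ydy_map_C, ydy_C, idy_Q1]
  refine (zero_sub (G := L2) _).trans ?_
  rw [map_neg, map_mul]
  exact neg_neg (G := L2) _

theorem xdx_Atilde : xdx Atilde = -(xinv * BofX) := by
  rw [Atilde_eq, xdx_sub, xdx_map_C, xdx_C, idy_Q1, BofX_eq]
  refine (sub_zero (G := L2) _).trans ?_
  ext1
  funext n
  rw [HahnSeries.coeff_neg, coeff_xinv_mul]
  simp [HahnSeries.coeff_single_mul]

theorem isUnit_one_sub_ofPowerSeries {R : Type*} [CommRing R] {P : PowerSeries R}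
    (hP : PowerSeries.constantCoeff P = 0) : IsUnit (1 - HahnSeries.ofPowerSeries ℤ R P) := by
  rw [← map_one (HahnSeries.ofPowerSeries ℤ R), ← map_sub]
  refine IsUnit.map _ (PowerSeries.isUnit_iff_constantCoeff.mpr ?_)
  simp [hP]

theorem isUnit_BofX : IsUnit BofX :=
  isUnit_one_sub_ofPowerSeries (by simp [← PowerSeries.coeff_zero_eq_constantCoeff_apply])

theorem isUnit_BofY : IsUnit BofY :=
  IsUnit.map HahnSeries.C
    (isUnit_one_sub_ofPowerSeries (by simp [← PowerSeries.coeff_zero_eq_constantCoeff_apply]))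

theorem isUnit_Aser : IsUnit Aser :=
  isUnit_one_sub_ofPowerSeries (by simp [← PowerSeries.coeff_zero_eq_constantCoeff_apply])

theorem xx_mul_xinv : xx * xinv = 1 := by
  simp [xx, xinv]

theorem yy_mul_yinv : yy * yinv = 1 := by
  simp [yy, yinv]

theorem sub_eq_mul_one_sub {R : Type*} [CommRing R] {a b c : R} (h : a * b = 1) :
    b - c = b * (1 - a * c) := by
  linear_combination c * h

theorem isUnit_Atilde : IsUnit Atilde := by
  refine IsUnit.mul ?_ isUnit_Aser
  have h : xinv - yinv = xinv * (1 - HahnSeries.ofPowerSeries ℤ L1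
      (PowerSeries.X * PowerSeries.C (HahnSeries.single (-1) 1))) := by
    rw [map_mul, HahnSeries.ofPowerSeries_X, HahnSeries.ofPowerSeries_C]
    change xinv - yinv = xinv * (1 - xx * yinv)
    exact sub_eq_mul_one_sub (R := L2) xx_mul_xinv
  rw [h]
  exact (IsUnit.of_mul_eq_one_right _ xx_mul_xinv).mul
    (isUnit_one_sub_ofPowerSeries (by simp))

theorem xdx_xx : xdx xx = xx := by
  ext1
  funext n
  change n • (HahnSeries.single 1 1 : L2).coeff n = (HahnSeries.single 1 1 : L2).coeff n
  rw [HahnSeries.coeff_single]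
  split_ifs with h
  · rw [h, one_smul]
  · rw [smul_zero]

theorem idy_y : idy (HahnSeries.single 1 1) = HahnSeries.single 1 1 := by
  ext1
  funext n
  change n • (HahnSeries.single 1 1 : L1).coeff n = (HahnSeries.single 1 1 : L1).coeff n
  rw [HahnSeries.coeff_single]
  split_ifs with h
  · rw [h, one_smul]
  · rw [smul_zero]

theorem ydy_xx : ydy xx = 0 := by
  ext1
  funext n
  change idy ((HahnSeries.single 1 1 : L2).coeff n) = 0
  rw [HahnSeries.coeff_single]
  split_ifs with h
  · exact leibniz_one (d := idyHom) idy_mul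
  · exact map_zero idyHom

theorem ydy_yy : ydy yy = yy :=
  (ydy_C _).trans (congrArg HahnSeries.C idy_y)

theorem sq_mul_eq {R : Type*} [CommRing R] {a b : R} (h : a * b = 1) : -(b ^ 2 * a) = -b := by
  linear_combination -b * h

theorem xdx_xinv : xdx xinv = -xinv := by
  have h : xdx xinv = -(xinv ^ 2 * xdx xx) :=
    leibniz_inverse (R := L2) (d := xdxHom) xdx_mul xx_mul_xinv
  rw [h, xdx_xx]
  exact sq_mul_eq (R := L2) xx_mul_xinv

theorem ydy_yinv : ydy yinv = -yinv := by
  have h : ydy yinv = -(yinv ^ 2 * ydy yy) :=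
    leibniz_inverse (R := L2) (d := ydyHom) ydy_mul yy_mul_yinv
  rw [h, ydy_yy]
  exact sq_mul_eq (R := L2) yy_mul_yinv

theorem ydy_xinv : ydy xinv = 0 := by
  have h : ydy xinv = -(xinv ^ 2 * ydy xx) :=
    leibniz_inverse (R := L2) (d := ydyHom) ydy_mul xx_mul_xinv
  rw [h, ydy_xx, mul_zero]
  exact neg_zero (G := L2)

theorem xdx_yinv : xdx yinv = 0 := xdx_C _

theorem xdx_xinv_sub_yinv : xdx (xinv - yinv) = -xinv := by
  rw [xdx_sub, xdx_xinv, xdx_yinv]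
  exact sub_zero (G := L2) _

theorem ydy_xinv_sub_yinv : ydy (xinv - yinv) = yinv := by
  rw [ydy_sub, ydy_xinv, ydy_yinv]
  exact (zero_sub (G := L2) _).trans (neg_neg (G := L2) _)

theorem zero_mul_sub_one_mul {R : Type*} [CommRing R] (a b : R) : 0 * a - 1 * b = -b := by
  ring

theorem ydy_mu (n : ℕ) : ydy (xx ^ n - yy ^ n) = -((n : L2) * yy ^ n) := by
  have hx : ydy (xx ^ n) = 0 * ((n : L2) * xx ^ n) :=
    leibniz_pow_of_eigen (R := L2) (d := ydyHom) ydy_mul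
      (ydy_xx.trans (zero_mul (M₀ := L2) _).symm) n
  have hy : ydy (yy ^ n) = 1 * ((n : L2) * yy ^ n) :=
    leibniz_pow_of_eigen (R := L2) (d := ydyHom) ydy_mul
      (ydy_yy.trans (one_mul (M := L2) _).symm) n
  rw [ydy_sub, hx, hy]
  exact zero_mul_sub_one_mul (R := L2) _ _

theorem mul_mul_eq_of_euler {R : Type*} [CommRing R] {a e l u v p q : R} (h : a * l = e)
    (hD : (u - v) * e + a * (-u + v) = -(u * p) + v * q) :
    (u - v) * a * l = v * q - u * p + (u - v) * a := by
  linear_combination (u - v) * h + hD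

theorem Atilde_mul_euler_logA :
    Atilde * euler logA = yinv * BofY - xinv * BofX + Atilde := by
  have h : euler Atilde = (xinv - yinv) * euler Aser + Aser * (-xinv + yinv) := by
    rw [Atilde, euler_mul, euler_apply (xinv - yinv), xdx_xinv_sub_yinv, ydy_xinv_sub_yinv]
  rw [euler_apply, xdx_Atilde, ydy_Atilde] at h
  exact mul_mul_eq_of_euler (R := L2) Aser_mul_euler_logA h.symm

/-- The algebraic identity behind the main theorem, with formal inverses `a`, `p`, `q` of
`Ã(x,y)`, `B(x)`, `B(y)`. -/
theorem main_identity {R : Type*} [CommRing R]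
    {x y u v A a P p Q q L K M : R} {n m : ℕ} (hx : x * u = 1) (hy : y * v = 1)
    (hA : A * a = 1) (hP : P * p = 1) (hQ : Q * q = 1) (hL : A * L = v * Q - u * P + A) :
    M * a ^ 2 * x ^ (m + 1) * v * p +
      (M * -(a ^ 2 * (v * Q)) + a * -(K * y ^ (n + 1))) * x ^ (m + 1) * (q * p) -
      K * (x ^ (m + 1) * y ^ (n + 2) * (q ^ 2 * p)) +
      K * (x ^ m * y ^ (n + 2) * (q ^ 2 * a)) +
      K * (x ^ (m + 1) * y ^ (n + 2) * (q ^ 2 * p)) * L = 0 := by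
  have hL' : L = 1 + a * (v * Q - u * P) := by
    linear_combination a * hL + (1 - L) * hA
  rw [hL']
  linear_combination
    (-(M * a ^ 2 * v * x ^ (m + 1) * p) + K * x ^ (m + 1) * y ^ (n + 1) * q * p * a) * hQ +
      K * x ^ (m + 1) * y ^ (n + 1) * q ^ 2 * p * a * Q * hy -
      K * x ^ m * y ^ (n + 2) * q ^ 2 * p * a * P * hx -
      K * x ^ m * y ^ (n + 2) * q ^ 2 * a * hP

end EulerIdentity

/-- for `c ≥ 2` and `f ≥ 1`, with `μ_c = x^(c-1) - y^(c-1)`,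
`μ_c/Ã² ⬝ x^f y⁻¹/B(x) + y∂_y(μ_c/Ã) ⬝ x^f/(B(x)B(y)) - (c-1) x^f y^c/(B(x)B(y)²)
 + x^(f-1) (c-1) y^c/(Ã B(y)²) + x^f (c-1) y^c/(B(x)B(y)²) ⬝ (x∂_x + y∂_y) log A = 0`. -/
theorem statement19 (c f : ℕ) (hc : 2 ≤ c) (hf : 1 ≤ f) :
    letI mu : L2 := xx ^ (c - 1) - yy ^ (c - 1)
    mu * Ring.inverse (Atilde ^ 2) * xx ^ f * yinv * Ring.inverse BofX +
      ydy (mu * Ring.inverse Atilde) * xx ^ f * Ring.inverse (BofX * BofY) -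
      ((c : ℚ) - 1) • (xx ^ f * yy ^ c * Ring.inverse (BofX * BofY ^ 2)) +
      ((c : ℚ) - 1) • (xx ^ (f - 1) * yy ^ c * Ring.inverse (Atilde * BofY ^ 2)) +
      ((c : ℚ) - 1) • (xx ^ f * yy ^ c * Ring.inverse (BofX * BofY ^ 2)) *
        (xdx logA + ydy logA) = 0 := by
  obtain ⟨n, rfl⟩ := Nat.exists_eq_add_of_le' hc
  obtain ⟨m, rfl⟩ := Nat.exists_eq_add_of_le' hf
  have hK : ∀ F : L2, (((n + 2 : ℕ) : ℚ) - 1) • F = ((n + 1 : ℕ) : L2) * F := by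
    intro F
    rw [← nsmul_eq_mul, ← Nat.cast_smul_eq_nsmul ℚ]
    congr 1
    push_cast
    ring
  have hA := Ring.mul_inverse_cancel _ EulerIdentity.isUnit_Atilde
  have hX := Ring.mul_inverse_cancel _ EulerIdentity.isUnit_BofX
  have hY := Ring.mul_inverse_cancel _ EulerIdentity.isUnit_BofY
  have hd : ydy (Ring.inverse Atilde) = -(Ring.inverse Atilde ^ 2 * (yinv * BofY)) := by
    rw [← EulerIdentity.ydy_Atilde]
    exact EulerIdentity.leibniz_inverse (R := L2) (d := EulerIdentity.ydyHom) EulerIdentity.ydy_mul hA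
  have hi : ∀ F G : L2, Ring.inverse (F * G) = Ring.inverse G * Ring.inverse F :=
    fun F G => Ring.mul_inverse_rev F G
  simp only [hK, Nat.add_sub_cancel, show n + 2 - 1 = n + 1 from rfl, EulerIdentity.ydy_mul, hd,
    EulerIdentity.ydy_mu, hi, ← Ring.inverse_pow]
  exact EulerIdentity.main_identity (R := L2) EulerIdentity.xx_mul_xinv EulerIdentity.yy_mul_yinv hA hX hY
    EulerIdentity.Atilde_mul_euler_logA
end
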